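/- Let R be a commutative Noetherian ring, 𝔞 an ideal of R, and M an R-module such that Ext^i_R(R/𝔞, M) is a finitely generated R-module for all i ≥ 0 and the local cohomology module H^i_𝔞(M) is an FD_{<2} R-module for all i ≥ 0. Then H^i_𝔞(M) is 𝔞-cofinite for all i ≥ 0. -/

import Mathlib

universe u

open CategoryTheory

/-- The `i`-th Ext module `Ext^i_R(N, M)`. -/
noncomputable def extModule (R : Type u) [CommRing R] (N M : Type u)
    [AddCommGroup N] [Module R N] [AddCommGroup M] [Module R M] (i : ℕ) :
    ModuleCat.{u} R :=
  ((Ext R (ModuleCat.{u} R) i).obj (Opposite.op (ModuleCat.of R N))).obj (ModuleCat.of R M)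

/-- The `i`-th local cohomology module `H^i_𝔞(M)`. -/
noncomputable def localCohomologyModule (R : Type u) [CommRing R] (𝔞 : Ideal R)
    (M : Type u) [AddCommGroup M] [Module R M] (i : ℕ) : ModuleCat.{u} R :=
  (localCohomology 𝔞 i).obj (ModuleCat.of R M)

/-- An `R`-module `M` is `𝔞`-cofinite if `Supp M ⊆ V(𝔞)` and all the modules
`Ext^i_R(R/𝔞, M)` are finitely generated. -/
def IsCofinite (R : Type u) [CommRing R] (𝔞 : Ideal R)
    (M : Type u) [AddCommGroup M] [Module R M] : Prop :=
  Module.support R M ⊆ PrimeSpectrum.zeroLocus (𝔞 : Set R) ∧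
    ∀ i : ℕ, Module.Finite R (extModule R (R ⧸ 𝔞) M i)

/-- An `R`-module `M` is `FD_{<n}` if it has a finitely generated submodule `N` such that
the (Krull) dimension of the support of `M/N` is `< n`. -/
def IsFDLT (R : Type u) [CommRing R] (n : ℕ)
    (M : Type u) [AddCommGroup M] [Module R M] : Prop :=
  ∃ N : Submodule R M, N.FG ∧
    Order.krullDim (Module.support R (M ⧸ N)) < ((n : ℕ∞) : WithBot ℕ∞)

namespace CofiniteModule

section ExtFinite
variable {R : Type u} [CommRing R] (𝔞 : Ideal R)

/-- The module `Ext^i_R(R/𝔞, X)` is finitely generated. -/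
def ExtFinite (X : Type u) [AddCommGroup X] [Module R X] (i : ℕ) : Prop :=
  Module.Finite R (Abelian.Ext (ModuleCat.of R (R ⧸ 𝔞)) (ModuleCat.of R X) i)

variable {X Y Z : Type u} [AddCommGroup X] [Module R X] [AddCommGroup Y] [Module R Y]
  [AddCommGroup Z] [Module R Z]

lemma shortExact_of {f : X →ₗ[R] Y} {g : Y →ₗ[R] Z} (hf : Function.Injective f)
    (hg : Function.Surjective g) (hfg : Function.Exact f g) :
    (ShortComplex.mk (ModuleCat.ofHom f) (ModuleCat.ofHom g) (by
      ext x; exact hfg.apply_apply_eq_zero x)).ShortExact where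
  exact := by
    rw [ShortComplex.ShortExact.moduleCat_exact_iff_function_exact]
    exact hfg
  mono_f := (ModuleCat.mono_iff_injective _).2 hf
  epi_g := (ModuleCat.epi_iff_surjective _).2 hg

lemma finite_of_exact [IsNoetherianRing R] {A B C : Type*} [AddCommGroup A] [Module R A]
    [AddCommGroup B] [Module R B] [AddCommGroup C] [Module R C] (f : A →ₗ[R] B) (g : B →ₗ[R] C)
    [Module.Finite R A] [Module.Finite R C] (h : ∀ b, g b = 0 → ∃ a, f a = b) :
    Module.Finite R B := by
  have : LinearMap.ker g ≤ LinearMap.range f := fun b hb => h b hb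
  have h1 : (LinearMap.ker g).FG := by
    have : Module.Finite R (LinearMap.range f) := inferInstance
    have := isNoetherian_submodule.1
      (isNoetherian_of_isNoetherianRing_of_finite R (LinearMap.range f)) _ ‹_›
    exact this
  have h2 : (LinearMap.range g).FG := IsNoetherian.noetherian _
  have : (⊤ : Submodule R B).FG := by
    apply Submodule.fg_of_fg_map_of_fg_inf_ker g
    · rwa [← LinearMap.range_eq_map]
    · simpa using h1
  exact ⟨this⟩

open Abelian.Ext in
lemma ExtFinite.middle [IsNoetherianRing R] {f : X →ₗ[R] Y} {g : Y →ₗ[R] Z}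
    (hf : Function.Injective f) (hg : Function.Surjective g) (hfg : Function.Exact f g) {i : ℕ}
    (hX : ExtFinite 𝔞 X i) (hZ : ExtFinite 𝔞 Z i) : ExtFinite 𝔞 Y i := by
  have hS := shortExact_of hf hg hfg
  unfold ExtFinite at *
  exact finite_of_exact
    ((mk₀ (ModuleCat.ofHom f)).postcompOfLinear R (ModuleCat.of R (R ⧸ 𝔞)) (add_zero i))
    ((mk₀ (ModuleCat.ofHom g)).postcompOfLinear R (ModuleCat.of R (R ⧸ 𝔞)) (add_zero i))
    (fun b hb => covariant_sequence_exact₂ _ hS b hb)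

open Abelian.Ext in
lemma ExtFinite.right [IsNoetherianRing R] {f : X →ₗ[R] Y} {g : Y →ₗ[R] Z}
    (hf : Function.Injective f) (hg : Function.Surjective g) (hfg : Function.Exact f g) {i : ℕ}
    (hY : ExtFinite 𝔞 Y i) (hX : ExtFinite 𝔞 X (i + 1)) : ExtFinite 𝔞 Z i := by
  have hS := shortExact_of hf hg hfg
  unfold ExtFinite at *
  exact finite_of_exact
    ((mk₀ (ModuleCat.ofHom g)).postcompOfLinear R (ModuleCat.of R (R ⧸ 𝔞)) (add_zero i))
    (hS.extClass.postcompOfLinear R (ModuleCat.of R (R ⧸ 𝔞)) rfl)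
    (fun b hb => covariant_sequence_exact₃ _ hS b rfl hb)

open Abelian.Ext in
lemma ExtFinite.left [IsNoetherianRing R] {f : X →ₗ[R] Y} {g : Y →ₗ[R] Z}
    (hf : Function.Injective f) (hg : Function.Surjective g) (hfg : Function.Exact f g) {i : ℕ}
    (hZ : ExtFinite 𝔞 Z i) (hY : ExtFinite 𝔞 Y (i + 1)) : ExtFinite 𝔞 X (i + 1) := by
  have hS := shortExact_of hf hg hfg
  unfold ExtFinite at *
  exact finite_of_exact
    (hS.extClass.postcompOfLinear R (ModuleCat.of R (R ⧸ 𝔞)) rfl)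
    ((mk₀ (ModuleCat.ofHom f)).postcompOfLinear R (ModuleCat.of R (R ⧸ 𝔞)) (add_zero (i + 1)))
    (fun b hb => covariant_sequence_exact₁ _ hS b hb rfl)

open Abelian.Ext in
lemma ExtFinite.of_linearEquiv (e : X ≃ₗ[R] Y) {i : ℕ} (hX : ExtFinite 𝔞 X i) :
    ExtFinite 𝔞 Y i := by
  unfold ExtFinite at *
  refine Module.Finite.of_surjective
    ((mk₀ (ModuleCat.ofHom e.toLinearMap)).postcompOfLinear R (ModuleCat.of R (R ⧸ 𝔞))
      (add_zero i)) fun y => ?_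
  refine ⟨y.comp (mk₀ (ModuleCat.ofHom e.symm.toLinearMap)) (add_zero i), ?_⟩
  simp [← ModuleCat.ofHom_comp]

lemma ExtFinite.of_finite [IsNoetherianRing R] [Module.Finite R X] (i : ℕ) : ExtFinite 𝔞 X i :=
  ModuleCat.finite_ext R (ModuleCat.of R (R ⧸ 𝔞)) (ModuleCat.of R X) i

/-- `Ext⁰(R/𝔞, X)` is the submodule of elements of `X` killed by `𝔞`. -/
noncomputable def ann (X : Type u) [AddCommGroup X] [Module R X] : Submodule R X :=
  Submodule.torsionBySet R X 𝔞

lemma mem_ann {x : X} : x ∈ ann 𝔞 X ↔ ∀ r ∈ 𝔞, r • x = 0 := by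
  simp [ann, Submodule.mem_torsionBySet_iff]

/-- `Hom(R/𝔞, X)` is the submodule of elements of `X` killed by `𝔞`. -/
noncomputable def homEquivAnn (X : Type u) [AddCommGroup X] [Module R X] :
    (ModuleCat.of R (R ⧸ 𝔞) ⟶ ModuleCat.of R X) ≃ₗ[R] ann 𝔞 X where
  toFun φ := ⟨φ.hom (Ideal.Quotient.mk 𝔞 1), (mem_ann 𝔞).2 fun r hr => by
    rw [← map_smul, ← Ideal.Quotient.mk_eq_mk, ← Submodule.Quotient.mk_smul,
      (Submodule.Quotient.mk_eq_zero 𝔞).2 (by simpa using hr), map_zero]⟩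
  invFun x := ModuleCat.ofHom (Submodule.liftQ 𝔞 (LinearMap.toSpanSingleton R X x)
    fun r hr => by simpa using (mem_ann 𝔞).1 x.2 r hr)
  map_add' _ _ := rfl
  map_smul' _ _ := rfl
  left_inv φ := by
    refine ModuleCat.hom_ext (LinearMap.ext fun x => ?_)
    obtain ⟨r, rfl⟩ := Submodule.Quotient.mk_surjective _ x
    change r • φ.hom (Submodule.Quotient.mk 1) = φ.hom (Submodule.Quotient.mk r)
    rw [← map_smul, ← Submodule.Quotient.mk_smul, smul_eq_mul, mul_one]
  right_inv x := by
    ext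
    change (1 : R) • (x : X) = x
    simp

lemma extFinite_zero_iff : ExtFinite 𝔞 X 0 ↔ Module.Finite R (ann 𝔞 X) :=
  Module.Finite.equiv_iff (Abelian.Ext.linearEquiv₀.trans (homEquivAnn 𝔞 X))

lemma ExtFinite.zero_of_injective [IsNoetherianRing R] {f : X →ₗ[R] Y}
    (hf : Function.Injective f) (hY : ExtFinite 𝔞 Y 0) : ExtFinite 𝔞 X 0 := by
  rw [extFinite_zero_iff] at *
  refine Module.Finite.of_injective (f.restrict (p := ann 𝔞 X) (q := ann 𝔞 Y) fun x hx => ?_) ?_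
  · rw [mem_ann] at *
    intro r hr
    rw [← map_smul, hx r hr, map_zero]
  · intro x y h
    ext
    exact hf (congrArg Subtype.val h)

/-- If `x ∈ 𝔞` and all `Ext^i(R/𝔞, 0 :_X x)` and `Ext^i(R/𝔞, X/xX)` are finitely generated,
then so are the `Ext^i(R/𝔞, X)`. -/
lemma ExtFinite.of_ker_coker [IsNoetherianRing R] {x : R} (hx : x ∈ 𝔞)
    (hK : ∀ i, ExtFinite 𝔞 (LinearMap.ker (LinearMap.lsmul R X x)) i)
    (hC : ∀ i, ExtFinite 𝔞 (X ⧸ LinearMap.range (LinearMap.lsmul R X x)) i) (i : ℕ) :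
    ExtFinite 𝔞 X i := by
  set f := LinearMap.lsmul R X x with hf
  have h1 : Function.Exact (LinearMap.ker f).subtype f.rangeRestrict := by
    intro y
    simp [Subtype.ext_iff]
  have h2 : Function.Exact (LinearMap.range f).subtype (LinearMap.range f).mkQ := by
    intro y
    simp
  cases i with
  | zero =>
    rw [extFinite_zero_iff]
    have := (extFinite_zero_iff 𝔞).1 (hK 0)
    let g : ann 𝔞 X →ₗ[R] ann 𝔞 (LinearMap.ker f) :=
      ((ann 𝔞 X).subtype.codRestrict (LinearMap.ker f) fun y =>
        (mem_ann 𝔞).1 y.2 x hx).codRestrict _ fun y => (mem_ann 𝔞).2 fun r hr =>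
          Subtype.ext ((mem_ann 𝔞).1 y.2 r hr)
    exact Module.Finite.of_injective g fun y z h => Subtype.ext (congrArg (fun w => w.1.1) h)
  | succ i =>
    have hS1 := shortExact_of (Submodule.subtype_injective _) f.surjective_rangeRestrict h1
    have hS2 := shortExact_of (Submodule.subtype_injective _)
      (Submodule.mkQ_surjective (LinearMap.range f)) h2
    have hK' := hK (i + 1)
    have hC' := hC i
    unfold ExtFinite at hK' hC' ⊢
    let N := ModuleCat.of R (R ⧸ 𝔞)
    let β := (Abelian.Ext.mk₀ (ModuleCat.ofHom (LinearMap.range f).subtype)).postcompOfLinear R N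
      (add_zero (i + 1))
    let α := (Abelian.Ext.mk₀ (ModuleCat.ofHom f.rangeRestrict)).postcompOfLinear R N
      (add_zero (i + 1))
    have hβ : Module.Finite R (LinearMap.ker β) := by
      refine Module.Finite.of_surjective
        ((hS2.extClass.postcompOfLinear R N rfl).codRestrict (LinearMap.ker β) fun c => ?_)
        fun b => ?_
      · simp only [LinearMap.mem_ker]
        change (c.comp hS2.extClass rfl).comp _ (add_zero (i + 1)) = 0
        have := hS2.extClass_comp
        dsimp at this
        rw [Abelian.Ext.comp_assoc_of_third_deg_zero, this, Abelian.Ext.comp_zero]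
      · obtain ⟨c, hc⟩ := Abelian.Ext.covariant_sequence_exact₁ _ hS2 b.1 b.2 rfl
        exact ⟨c, Subtype.ext hc⟩
    have hβα : ∀ e, β (α e) = 0 := by
      intro e
      change (e.comp (Abelian.Ext.mk₀ (ModuleCat.ofHom f.rangeRestrict)) (add_zero (i+1))).comp
        (Abelian.Ext.mk₀ (ModuleCat.ofHom (LinearMap.range f).subtype)) (add_zero (i+1)) = 0
      rw [Abelian.Ext.comp_assoc_of_third_deg_zero, Abelian.Ext.mk₀_comp_mk₀,
        ← ModuleCat.ofHom_comp]
      have : ModuleCat.ofHom ((LinearMap.range f).subtype ∘ₗ f.rangeRestrict)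
        = x • 𝟙 (ModuleCat.of R X) := by
        ext y; rfl
      rw [this, ← Abelian.Ext.smul_eq_comp_mk₀]
      have h0 : x • 𝟙 N = 0 := by
        refine ModuleCat.hom_ext (LinearMap.ext fun y => ?_)
        obtain ⟨r, rfl⟩ := Submodule.Quotient.mk_surjective _ y
        change x • (Submodule.Quotient.mk r : R ⧸ 𝔞) = 0
        rw [← Submodule.Quotient.mk_smul, Submodule.Quotient.mk_eq_zero]
        exact 𝔞.mul_mem_right _ hx
      have : x • e = (Abelian.Ext.mk₀ (x • 𝟙 N)).comp e (zero_add _) := by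
        simp [Abelian.Ext.mk₀_smul]
      rw [this, h0, Abelian.Ext.mk₀_zero, Abelian.Ext.zero_comp]
    exact finite_of_exact
      ((Abelian.Ext.mk₀ (ModuleCat.ofHom (LinearMap.ker f).subtype)).postcompOfLinear R N
        (add_zero (i + 1)))
      (α.codRestrict (LinearMap.ker β) hβα)
      (fun b hb => Abelian.Ext.covariant_sequence_exact₂ _ hS1 b (congrArg Subtype.val hb))

end ExtFinite

section Torsion
variable {R : Type*} [CommRing R] {X : Type*} [AddCommGroup X] [Module R X]

/-- A module is Artinian if every element is killed by a power of `x` and the kernel of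
multiplication by `x` is Artinian. -/
lemma isArtinian_of_ker_lsmul (x : R) (hx : ∀ y : X, ∃ n : ℕ, x ^ n • y = 0)
    [hK : IsArtinian R (LinearMap.ker (LinearMap.lsmul R X x))] : IsArtinian R X := by
  rw [← monotone_stabilizes_iff_artinian] at *
  intro N
  have hN : ∀ {k l : ℕ}, k ≤ l → OrderDual.ofDual (N l) ≤ OrderDual.ofDual (N k) :=
    fun h => N.monotone h
  set K := LinearMap.ker (LinearMap.lsmul R X x)
  let L (k i : ℕ) : Submodule R K :=
    (Submodule.map (LinearMap.lsmul R X (x ^ i)) (OrderDual.ofDual (N k))).comap K.subtype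
  have hL1 : ∀ {k l : ℕ} (i : ℕ), k ≤ l → L l i ≤ L k i := fun i h =>
    Submodule.comap_mono (Submodule.map_mono (hN h))
  have hL2 : ∀ {i j : ℕ} (k : ℕ), i ≤ j → L k j ≤ L k i := by
    intro i j k h
    refine Submodule.comap_mono ?_
    rintro _ ⟨y, hy, rfl⟩
    refine ⟨x ^ (j - i) • y, Submodule.smul_mem _ _ hy, ?_⟩
    simp [smul_smul, ← pow_add, Nat.sub_add_cancel h]
  obtain ⟨n, hn⟩ := hK ⟨fun k => OrderDual.toDual (L k k), fun k l h =>
    OrderDual.toDual_le_toDual.2 ((hL1 _ h).trans (hL2 _ h))⟩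
  choose k hk using fun i => hK ⟨fun k => OrderDual.toDual (L k i), fun k l h =>
    OrderDual.toDual_le_toDual.2 (hL1 _ h)⟩
  let k₀ := n ⊔ (Finset.range n).sup k
  have key : ∀ l, k₀ ≤ l → ∀ i, L k₀ i ≤ L l i := by
    intro l hl i
    rcases lt_or_ge i n with hi | hi
    · have h0 : k i ≤ k₀ := (Finset.le_sup (Finset.mem_range.2 hi)).trans le_sup_right
      have h1 := hk i k₀ h0
      have h2 := hk i l (h0.trans hl)
      exact (OrderDual.toDual_inj.1 (h1.symm.trans h2)).le
    · have h0 : n ≤ k₀ := le_sup_left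
      calc L k₀ i ≤ L n n := (hL1 _ h0).trans (hL2 _ hi)
        _ = L (i ⊔ l) (i ⊔ l) := OrderDual.toDual_inj.1 (hn _ (hi.trans le_sup_left))
        _ ≤ L l i := (hL1 _ le_sup_right).trans (hL2 _ le_sup_left)
  refine ⟨k₀, fun l hl => OrderDual.ofDual_inj.1 (le_antisymm ?_ (hN hl))⟩
  have : ∀ (m : ℕ) (y : X), y ∈ OrderDual.ofDual (N k₀) → x ^ m • y = 0 →
      y ∈ OrderDual.ofDual (N l) := by
    intro m
    induction m with
    | zero =>
      intro y _ h
      simp only [pow_zero, one_smul] at h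
      rw [h]
      exact Submodule.zero_mem _
    | succ m ih =>
      intro y hy h
      have hz : x ^ m • y ∈ K := by
        rw [pow_succ', mul_smul] at h
        exact h
      have : (⟨x ^ m • y, hz⟩ : K) ∈ L k₀ m := ⟨y, hy, rfl⟩
      obtain ⟨y', hy', h'⟩ := key l hl m this
      have h' : x ^ m • y' = x ^ m • y := h'
      have := ih (y - y') (sub_mem hy (hN hl hy')) (by rw [smul_sub, h', sub_self])
      simpa using add_mem this hy'
  intro y hy
  obtain ⟨m, hm⟩ := hx y
  exact this m y hy hm

lemma isArtinian_of_torsionBySet (s : Finset R) (hs : ∀ a ∈ s, ∀ y : X, ∃ n : ℕ, a ^ n • y = 0)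
    (h : IsArtinian R (Submodule.torsionBySet R X (s : Set R))) : IsArtinian R X := by
  classical
  induction s using Finset.induction_on with
  | empty =>
    refine isArtinian_of_injective (LinearMap.codRestrict
      (Submodule.torsionBySet R X ((∅ : Finset R) : Set R)) LinearMap.id fun y => ?_) ?_
    · simp [Submodule.mem_torsionBySet_iff]
    · intro y z h
      exact congrArg Subtype.val h
  | insert a s _ ih =>
    refine ih (fun b hb => hs b (Finset.mem_insert_of_mem hb)) ?_
    have : IsArtinian R (LinearMap.ker
        (LinearMap.lsmul R (Submodule.torsionBySet R X (s : Set R)) a)) := by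
      refine isArtinian_of_injective (LinearMap.codRestrict
        (Submodule.torsionBySet R X ((insert a s : Finset R) : Set R))
        ((Submodule.subtype _) ∘ₗ (Submodule.subtype _)) fun y => ?_) ?_
      · rw [Submodule.mem_torsionBySet_iff]
        rintro ⟨b, hb⟩
        rcases Finset.mem_insert.1 hb with rfl | hb
        · exact congrArg Subtype.val y.2
        · exact (Submodule.mem_torsionBySet_iff _ _).1 y.1.2 ⟨b, hb⟩
      · intro y z h
        have h' := congrArg Subtype.val h
        exact Subtype.ext (Subtype.ext h')
    refine isArtinian_of_ker_lsmul a fun y => ?_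
    obtain ⟨n, hn⟩ := hs a (Finset.mem_insert_self _ _) y
    exact ⟨n, Subtype.ext hn⟩

variable (𝔞 : Ideal R)

/-- Every element of `X` is killed by a power of `𝔞`. -/
def IsTors (X : Type*) [AddCommGroup X] [Module R X] : Prop :=
  ∀ x : X, ∃ n : ℕ, ∀ r ∈ 𝔞 ^ n, r • x = 0

variable {𝔞} {Y : Type*} [AddCommGroup Y] [Module R Y]

lemma IsTors.of_injective (h : IsTors 𝔞 Y) (f : X →ₗ[R] Y) (hf : Function.Injective f) :
    IsTors 𝔞 X := fun x => by
  obtain ⟨n, hn⟩ := h (f x)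
  exact ⟨n, fun r hr => hf (by rw [map_smul, hn r hr, map_zero])⟩

lemma IsTors.of_surjective (h : IsTors 𝔞 X) (f : X →ₗ[R] Y) (hf : Function.Surjective f) :
    IsTors 𝔞 Y := fun y => by
  obtain ⟨x, rfl⟩ := hf y
  obtain ⟨n, hn⟩ := h x
  exact ⟨n, fun r hr => by rw [← map_smul, hn r hr, map_zero]⟩

end Torsion

section Noetherian
variable {R : Type u} [CommRing R] [IsNoetherianRing R] {𝔞 : Ideal R}
  {X : Type u} [AddCommGroup X] [Module R X]

/-- Melkersson's criterion. -/
lemma IsTors.isArtinian (h : IsTors 𝔞 X) (hX : IsArtinian R (ann 𝔞 X)) : IsArtinian R X := by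
  obtain ⟨s, hs⟩ := IsNoetherian.noetherian 𝔞
  refine isArtinian_of_torsionBySet s (fun a ha y => ?_) ?_
  · obtain ⟨n, hn⟩ := h y
    exact ⟨n, hn _ (Ideal.pow_mem_pow (hs ▸ Submodule.subset_span ha) n)⟩
  · rw [Submodule.torsionBySet_eq_torsionBySet_span]
    change IsArtinian R (Submodule.torsionBySet R X (Submodule.span R (s : Set R) : Ideal R))
    rwa [hs]

end Noetherian

section Zero
variable {R : Type u} [CommRing R] [IsNoetherianRing R] {𝔞 : Ideal R}

lemma finite_ann_of_injective {X Y : Type u} [AddCommGroup X] [Module R X] [AddCommGroup Y]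
    [Module R Y] (f : X →ₗ[R] Y) (hf : Function.Injective f) (hY : Module.Finite R (ann 𝔞 Y)) :
    Module.Finite R (ann 𝔞 X) := by
  rw [← extFinite_zero_iff] at *
  exact ExtFinite.zero_of_injective 𝔞 hf hY

lemma finite_of_pow_smul_eq_zero (n : ℕ) : ∀ (X : Type u) [AddCommGroup X] [Module R X],
    (∀ r ∈ 𝔞 ^ n, ∀ x : X, r • x = 0) → Module.Finite R (ann 𝔞 X) → Module.Finite R X := by
  induction n with
  | zero =>
    intro X _ _ h _
    have : Subsingleton X := ⟨fun x y => by
      rw [← one_smul R x, ← one_smul R y, h 1 (by simp), h 1 (by simp)]⟩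
    infer_instance
  | succ n ih =>
    intro X _ _ h hX
    obtain ⟨s, hs⟩ := IsNoetherian.noetherian 𝔞
    let P : Submodule R X := 𝔞 • ⊤
    have hP : Module.Finite R P := by
      refine ih P (fun r hr y => ?_) (finite_ann_of_injective P.subtype P.subtype_injective hX)
      obtain ⟨y, hy⟩ := y
      ext
      change r • y = 0
      refine Submodule.smul_induction_on hy (fun a ha x _ => ?_) (fun x y hx hy => ?_)
      · rw [smul_smul]
        exact h _ (pow_succ 𝔞 n ▸ Ideal.mul_mem_mul hr ha) x
      · rw [smul_add, hx, hy, add_zero]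
    let g : X →ₗ[R] (s → P) := LinearMap.pi fun a =>
      (LinearMap.lsmul R X a.1).codRestrict P fun x =>
        Submodule.smul_mem_smul (hs ▸ Submodule.subset_span a.2) trivial
    refine finite_of_exact (ann 𝔞 X).subtype g fun x hx => ⟨⟨x, (mem_ann 𝔞).2 ?_⟩, rfl⟩
    have hx' : ∀ a ∈ s, a • x = 0 := fun a ha => congrArg Subtype.val (congrFun hx ⟨a, ha⟩)
    intro r hr
    rw [← hs] at hr
    have : Submodule.span R (s : Set R) ≤ LinearMap.ker (LinearMap.toSpanSingleton R X x) :=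
      Submodule.span_le.2 fun a ha => hx' a ha
    exact this hr

lemma isArtinian_of_isMaximal {R : Type*} [CommRing R] [IsNoetherianRing R] {X : Type*}
    [AddCommGroup X] [Module R X] [Module.Finite R X]
    (h : ∀ p : Ideal R, p.IsPrime → Module.annihilator R X ≤ p → p.IsMaximal) :
    IsArtinian R X := by
  let I := Module.annihilator R X
  have : Ring.KrullDimLE 0 (R ⧸ I) := Ring.KrullDimLE.mk₀ fun p hp => by
    have h1 := h (p.comap (Ideal.Quotient.mk I)) (hp.comap _) (by
      intro r hr
      rw [Ideal.mem_comap, Ideal.Quotient.eq_zero_iff_mem.2 hr]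
      exact p.zero_mem)
    rw [← Ideal.map_comap_of_surjective _ Ideal.Quotient.mk_surjective p]
    refine (Ideal.map_eq_top_or_isMaximal_of_surjective _ Ideal.Quotient.mk_surjective h1).resolve_left
      fun h2 => hp.ne_top ?_
    rwa [Ideal.map_comap_of_surjective _ Ideal.Quotient.mk_surjective p] at h2
  have : IsArtinianRing (R ⧸ I) := IsNoetherianRing.isArtinianRing_of_krullDimLE_zero
  have hI : Module.IsTorsionBySet R X I := fun x r => Module.mem_annihilator.1 r.2 x
  let : Module (R ⧸ I) X := hI.module
  have : IsScalarTower R (R ⧸ I) X := hI.isScalarTower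
  have : Module.Finite (R ⧸ I) X := Module.Finite.of_restrictScalars_finite R _ _
  exact isArtinian_of_surjective_algebraMap (R := R ⧸ I) Ideal.Quotient.mk_surjective

lemma SupIrred.map_lsmul_eq_or_mem_radical {R : Type*} [CommRing R] {X : Type*}
    [AddCommGroup X] [Module R X] [IsArtinian R X] {S : Submodule R X} (hS : SupIrred S) (r : R) :
    S.map (LinearMap.lsmul R X r) = S ∨ r ∈ S.annihilator.radical := by
  let T (n : ℕ) : Submodule R X := S.map (LinearMap.lsmul R X (r ^ n))
  have hT : ∀ {m n : ℕ}, m ≤ n → T n ≤ T m := by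
    rintro m n h _ ⟨y, hy, rfl⟩
    refine ⟨r ^ (n - m) • y, S.smul_mem _ hy, ?_⟩
    simp [smul_smul, ← pow_add, Nat.sub_add_cancel h]
  obtain ⟨n, hn⟩ := IsArtinian.monotone_stabilizes (R := R) (M := X)
    ⟨fun n => OrderDual.toDual (T n), fun k l h => OrderDual.toDual_le_toDual.2 (hT h)⟩
  have hn : ∀ m, n ≤ m → T n = T m := fun m h => OrderDual.toDual_inj.1 (hn m h)
  have hle : T n ≤ S := by
    rintro _ ⟨y, hy, rfl⟩
    exact S.smul_mem _ hy
  have hsup : T n ⊔ S ⊓ LinearMap.ker (LinearMap.lsmul R X (r ^ n)) = S := by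
    refine le_antisymm (sup_le hle inf_le_left) fun y hy => ?_
    have : r ^ n • y ∈ T (n + n) := hn (n + n) (by lia) ▸ ⟨y, hy, rfl⟩
    obtain ⟨z, hz, h⟩ := this
    replace h : r ^ (n + n) • z = r ^ n • y := h
    refine Submodule.mem_sup.2 ⟨r ^ n • z, ⟨z, hz, rfl⟩, y - r ^ n • z,
      ⟨S.sub_mem hy (S.smul_mem _ hz), ?_⟩, by abel⟩
    simp [smul_sub, smul_smul, ← pow_add, h]
  rcases hS.2 hsup with h | h
  · left
    refine le_antisymm ?_ ?_
    · rintro _ ⟨y, hy, rfl⟩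
      exact S.smul_mem _ hy
    · calc S = T (n + 1) := by rw [← hn (n + 1) (by lia), h]
        _ ≤ T 1 := hT (by lia)
        _ ≤ _ := by simp [T]
  · right
    refine ⟨n, Submodule.mem_annihilator.2 fun y hy => ?_⟩
    rw [← h] at hy
    exact hy.2

lemma SupIrred.isPrime_radical {R : Type*} [CommRing R] {X : Type*}
    [AddCommGroup X] [Module R X] [IsArtinian R X] {S : Submodule R X} (hS : SupIrred S) :
    S.annihilator.radical.IsPrime where
  ne_top' h := by
    have h1 := (Ideal.eq_top_iff_one _).1 (Ideal.radical_eq_top.1 h)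
    refine hS.1 fun T _ y hy => ?_
    have := Submodule.mem_annihilator.1 h1 y hy
    rw [one_smul] at this
    exact this ▸ T.zero_mem
  mem_or_mem' {r s} hrs := by
    rcases SupIrred.map_lsmul_eq_or_mem_radical hS r with h | h
    · right
      obtain ⟨n, hn⟩ := hrs
      refine ⟨n, Submodule.mem_annihilator.2 fun y hy => ?_⟩
      have : ∀ k : ℕ, ∀ y ∈ S, ∃ z ∈ S, r ^ k • z = y := by
        intro k
        induction k with
        | zero => intro y hy; exact ⟨y, hy, by simp⟩
        | succ k ih =>
          intro y hy
          rw [← h] at hy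
          obtain ⟨w, hw, rfl⟩ := hy
          obtain ⟨z, hz, rfl⟩ := ih w hw
          exact ⟨z, hz, by simp [smul_smul, pow_succ, mul_comm]⟩
      obtain ⟨z, hz, rfl⟩ := this n y hy
      rw [smul_smul, mul_comm, ← mul_pow]
      exact Submodule.mem_annihilator.1 hn z hz
    · exact Or.inl h

lemma exists_range_lsmul_eq_top {X : Type*} [AddCommGroup X] [Module R X] [IsArtinian R X]
    (h : 𝔞 • (⊤ : Submodule R X) = ⊤) : ∃ x ∈ 𝔞, LinearMap.range (LinearMap.lsmul R X x) = ⊤ := by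
  classical
  obtain ⟨t, ht, htS⟩ := exists_supIrred_decomposition (⊤ : Submodule R X)
  let t' := t.filter fun S => ¬ 𝔞 ≤ S.annihilator.radical
  have h1 : ∀ S ∈ t, ∃ n : ℕ, 𝔞 ≤ S.annihilator.radical → 𝔞 ^ n ≤ S.annihilator := by
    intro S _
    by_cases hS : 𝔞 ≤ S.annihilator.radical
    · obtain ⟨n, hn⟩ := Ideal.exists_pow_le_of_le_radical_of_fg hS (IsNoetherian.noetherian _)
      exact ⟨n, fun _ => hn⟩
    · exact ⟨0, fun h => absurd h hS⟩
  choose! n hn using h1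
  let m := t.sup n
  have hm : ∀ k : ℕ, 𝔞 ^ k • (⊤ : Submodule R X) = ⊤ := by
    intro k
    induction k with
    | zero => simp
    | succ k ih => rw [pow_succ, Submodule.mul_smul, h, ih]
  have ht' : t'.sup id = ⊤ := by
    refine top_le_iff.1 ?_
    rw [← hm m, ← ht, Finset.sup_eq_iSup, Submodule.smul_iSup]
    refine iSup_le fun S => ?_
    rw [Submodule.smul_iSup]
    refine iSup_le fun hS => ?_
    by_cases hS' : 𝔞 ≤ S.annihilator.radical
    · have : 𝔞 ^ m ≤ S.annihilator :=
        (Ideal.pow_le_pow_right (Finset.le_sup hS)).trans (hn S hS hS')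
      refine Submodule.smul_le.2 fun r hr y hy => ?_
      rw [Submodule.mem_annihilator.1 (this hr) y hy]
      exact Submodule.zero_mem _
    · exact Submodule.smul_le_right.trans
        (Finset.le_sup (f := id) (Finset.mem_filter.2 ⟨hS, hS'⟩))
  have hav : ¬ ((𝔞 : Set R) ⊆ ⋃ S ∈ (t' : Set (Submodule R X)), S.annihilator.radical) := by
    rw [Ideal.subset_union_prime (s := t') (f := fun S => S.annihilator.radical) ⊥ ⊥
      (fun S hS _ _ => SupIrred.isPrime_radical (htS (Finset.mem_filter.1 hS).1))]
    rintro ⟨S, hS, h⟩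
    exact (Finset.mem_filter.1 hS).2 h
  obtain ⟨x, hx, hx'⟩ := Set.not_subset.1 hav
  refine ⟨x, hx, top_le_iff.1 ?_⟩
  rw [← ht']
  refine Finset.sup_le fun S hS => ?_
  have : x ∉ S.annihilator.radical := fun h => hx' (Set.mem_biUnion hS h)
  have := (SupIrred.map_lsmul_eq_or_mem_radical (htS (Finset.mem_filter.1 hS).1) x).resolve_right
    this
  exact this.ge.trans LinearMap.map_le_range

/-- If `X` is `𝔞`-torsion and `0 :_X 𝔞` has finite length, then `X` is `𝔞`-cofinite and
`X/xX` is finitely generated for some `x ∈ 𝔞`. -/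
lemma IsTors.extFinite_of_isArtinian (J : Ideal R) : ∀ (X : Type u) [AddCommGroup X] [Module R X],
    (∀ r ∈ J, ∀ x : X, r • x = 0) → IsTors 𝔞 X → Module.Finite R (ann 𝔞 X) →
    IsArtinian R (ann 𝔞 X) → (∀ i, ExtFinite 𝔞 X i) ∧
      ∃ x ∈ 𝔞, Module.Finite R (X ⧸ LinearMap.range (LinearMap.lsmul R X x)) := by
  induction J using IsNoetherian.induction with
  | _ J ih =>
  intro X _ _ hJ hT hfin hart
  have := hT.isArtinian hart
  obtain ⟨n, hn⟩ := IsArtinian.monotone_stabilizes (R := R) (M := X)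
    ⟨fun n => OrderDual.toDual (𝔞 ^ n • (⊤ : Submodule R X)), fun k l h =>
      OrderDual.toDual_le_toDual.2 (Submodule.smul_mono_left (Ideal.pow_le_pow_right h))⟩
  let Y : Submodule R X := 𝔞 ^ n • ⊤
  have hY : 𝔞 • Y = Y := by
    have := OrderDual.toDual_inj.1 (hn (n + 1) (by lia))
    calc 𝔞 • Y = 𝔞 ^ (n + 1) • ⊤ := by rw [pow_succ', Submodule.mul_smul]
      _ = Y := this.symm
  have hY' : 𝔞 • (⊤ : Submodule R Y) = ⊤ := by
    apply Submodule.map_injective_of_injective Y.subtype_injective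
    rw [Submodule.map_smul'', Submodule.map_subtype_top, hY]
  obtain ⟨x, hx, hxY⟩ := exists_range_lsmul_eq_top hY'
  have hYfin : Module.Finite R (ann 𝔞 Y) := finite_ann_of_injective _ Y.subtype_injective hfin
  have hYext : ∀ i, ExtFinite 𝔞 Y i := by
    by_cases hxJ : x ∈ J
    · have : Subsingleton Y := by
        refine subsingleton_of_forall_eq 0 fun y => ?_
        obtain ⟨z, rfl⟩ := LinearMap.range_eq_top.1 hxY y
        exact Subtype.ext (hJ x hxJ z)
      intro i
      exact ExtFinite.of_finite 𝔞 i
    · let K := LinearMap.ker (LinearMap.lsmul R Y x)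
      let f : K →ₗ[R] X := Y.subtype ∘ₗ K.subtype
      have hf : Function.Injective f := Y.subtype_injective.comp K.subtype_injective
      refine ExtFinite.of_ker_coker 𝔞 hx ?_ ?_
      · have hlt : J < J ⊔ Ideal.span {x} := lt_of_le_of_ne le_sup_left fun h =>
          hxJ (h ▸ Ideal.mem_sup_right (Ideal.mem_span_singleton_self x))
        refine (ih _ hlt K ?_ (hT.of_injective f hf) (finite_ann_of_injective f hf hfin) ?_).1
        · intro r hr y
          obtain ⟨a, ha, b, hb, rfl⟩ := Submodule.mem_sup.1 hr
          obtain ⟨c, rfl⟩ := Ideal.mem_span_singleton'.1 hb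
          rw [add_smul, mul_smul]
          have h1 : a • y = 0 := hf (by rw [map_smul, hJ a ha, map_zero])
          have h2 : x • y = 0 := Subtype.ext y.2
          rw [h1, h2, smul_zero, add_zero]
        · infer_instance
      · intro i
        have : Subsingleton (Y ⧸ LinearMap.range (LinearMap.lsmul R Y x)) :=
          Submodule.Quotient.subsingleton_iff.2 hxY
        exact ExtFinite.of_finite 𝔞 i
  have hex : Function.Exact Y.subtype Y.mkQ := LinearMap.exact_subtype_mkQ Y
  have hQ : Module.Finite R (X ⧸ Y) := by
    refine finite_of_pow_smul_eq_zero (𝔞 := 𝔞) n _ (fun r hr y => ?_) ?_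
    · obtain ⟨y, rfl⟩ := Y.mkQ_surjective y
      rw [← map_smul]
      exact (Submodule.Quotient.mk_eq_zero _).2 (Submodule.smul_mem_smul hr trivial)
    · rw [← extFinite_zero_iff] at *
      exact ExtFinite.right 𝔞 Y.subtype_injective Y.mkQ_surjective hex hfin (hYext 1)
  refine ⟨fun i => ExtFinite.middle 𝔞 Y.subtype_injective Y.mkQ_surjective hex (hYext i)
    (ExtFinite.of_finite 𝔞 i), x, hx, ?_⟩
  have hle : Y ≤ LinearMap.range (LinearMap.lsmul R X x) := fun y hy => by
    obtain ⟨z, hz⟩ := LinearMap.range_eq_top.1 hxY ⟨y, hy⟩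
    exact ⟨z, congrArg Subtype.val hz⟩
  exact Module.Finite.of_surjective (Submodule.factor hle) (Submodule.factor_surjective hle)

end Zero

section One

lemma IsTors.localizedModule {R : Type*} [CommRing R] {𝔞 : Ideal R} {X : Type*}
    [AddCommGroup X] [Module R X] (hT : IsTors 𝔞 X) (S : Submonoid R) :
    IsTors (𝔞.map (algebraMap R (Localization S))) (LocalizedModule S X) := by
  intro z
  induction z with
  | _ x s =>
  obtain ⟨n, hn⟩ := hT x
  refine ⟨n, ?_⟩
  rw [← Ideal.map_pow]
  have : (𝔞 ^ n).map (algebraMap R (Localization S)) ≤ LinearMap.ker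
      (LinearMap.toSpanSingleton (Localization S) (LocalizedModule S X) (.mk x s)) := by
    refine Ideal.map_le_iff_le_comap.2 fun r hr => ?_
    change algebraMap R (Localization S) r • LocalizedModule.mk x s = 0
    rw [algebraMap_smul, LocalizedModule.smul'_mk, hn r hr, LocalizedModule.zero_mk]
  exact fun r hr => this hr

variable {R : Type u} [CommRing R] [IsNoetherianRing R] {𝔞 : Ideal R}

lemma exists_forall_smul_smul_eq_zero (𝔞 : Ideal R) (S : Submonoid R) {X : Type*} [AddCommGroup X]
    [Module R X] (v : X) (h : ∀ a ∈ 𝔞, ∃ t ∈ S, t • a • v = 0) :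
    ∃ t ∈ S, ∀ a ∈ 𝔞, t • a • v = 0 := by
  classical
  obtain ⟨s, hs⟩ := IsNoetherian.noetherian 𝔞
  have : ∀ a ∈ s, ∃ t ∈ S, t • a • v = 0 := fun a ha => h a (hs ▸ Submodule.subset_span ha)
  choose! t ht htv using this
  refine ⟨∏ a ∈ s, t a, S.prod_mem ht, ?_⟩
  have hle : Submodule.span R (s : Set R) ≤
      LinearMap.ker (LinearMap.toSpanSingleton R X ((∏ a ∈ s, t a) • v)) := by
    refine Submodule.span_le.2 fun a ha => ?_
    change a • (∏ a ∈ s, t a) • v = 0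
    rw [← Finset.mul_prod_erase s t ha, mul_comm, mul_smul, smul_comm a, smul_comm a, htv a ha,
      smul_zero]
  intro a ha
  rw [smul_comm]
  rw [← hs] at ha
  exact hle ha

lemma mem_support_ann {X : Type*} [AddCommGroup X] [Module R X] (p : PrimeSpectrum R) (n : ℕ) :
    ∀ x : X, (∀ r ∈ 𝔞 ^ n, r • x = 0) → (∀ s ∉ p.asIdeal, s • x ≠ 0) →
      p ∈ Module.support R (Submodule.torsionBySet R X 𝔞) := by
  induction n with
  | zero =>
    intro x hx h
    exact absurd (hx 1 (by simp)) (h 1 (fun h1 => p.isPrime.ne_top ((Ideal.eq_top_iff_one _).2 h1)))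
  | succ n ih =>
    intro x hx h
    by_cases hc : ∃ a ∈ 𝔞, ∀ s ∉ p.asIdeal, s • a • x ≠ 0
    · obtain ⟨a, ha, has⟩ := hc
      refine ih (a • x) (fun r hr => ?_) has
      rw [smul_smul]
      exact hx _ (pow_succ 𝔞 n ▸ Ideal.mul_mem_mul hr ha)
    · push Not at hc
      obtain ⟨t, ht, htx⟩ := exists_forall_smul_smul_eq_zero 𝔞 p.asIdeal.primeCompl x hc
      rw [Module.mem_support_iff']
      refine ⟨⟨t • x, (Submodule.mem_torsionBySet_iff _ _).2 fun a => ?_⟩, fun s hs h0 => ?_⟩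
      · rw [smul_comm]
        exact htx _ a.2
      · refine h (s * t) (p.isPrime.mul_notMem hs ht) ?_
        rw [mul_smul]
        exact congrArg Subtype.val h0

lemma IsTors.support_ann {X : Type u} [AddCommGroup X] [Module R X] (h : IsTors 𝔞 X) :
    Module.support R (ann 𝔞 X) = Module.support R X := by
  refine le_antisymm (Module.support_subset_of_injective _ (ann 𝔞 X).subtype_injective)
    fun p hp => ?_
  obtain ⟨x, hx⟩ := Module.mem_support_iff'.1 hp
  obtain ⟨n, hn⟩ := h x
  exact mem_support_ann p n x hn hx

/-- The support of `X` has dimension at most one, in the sense that its non-minimal elements are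
maximal ideals. -/
def SuppDimLEOne (R : Type*) [CommRing R] (X : Type*) [AddCommGroup X] [Module R X] : Prop :=
  ∀ p ∈ Module.support R X, ∀ q : PrimeSpectrum R, p < q → q.asIdeal.IsMaximal

lemma finite_nonmaximal_support {X : Type u} [AddCommGroup X] [Module R X] (hT : IsTors 𝔞 X)
    (hfin : Module.Finite R (ann 𝔞 X)) (hdim : SuppDimLEOne R X) :
    {p ∈ Module.support R X | ¬ p.asIdeal.IsMaximal}.Finite := by
  refine Set.Finite.of_finite_image (f := PrimeSpectrum.asIdeal)
    ((Ideal.finite_minimalPrimes_of_isNoetherianRing R (Module.annihilator R (ann 𝔞 X))).subset ?_)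
    (fun p _ q _ h => PrimeSpectrum.ext h)
  rintro _ ⟨p, ⟨hp, hmax⟩, rfl⟩
  rw [← hT.support_ann] at hp
  refine ⟨⟨p.isPrime, Module.mem_support_iff_of_finite.1 hp⟩, fun q hq hqp => ?_⟩
  by_contra hne
  have hq' : (⟨q, hq.1⟩ : PrimeSpectrum R) ∈ Module.support R X := by
    rw [← hT.support_ann]
    exact Module.mem_support_iff_of_finite.2 hq.2
  exact hmax (hdim _ hq' p (lt_of_le_not_ge hqp hne))

lemma ann_localizedModule_le {X : Type u} [AddCommGroup X] [Module R X] (S : Submonoid R) :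
    ann (𝔞.map (algebraMap R (Localization S))) (LocalizedModule S X) ≤
      (ann 𝔞 X).localized S := by
  intro z hz
  rw [mem_ann] at hz
  induction z with
  | _ x s =>
  have : ∀ a ∈ 𝔞, ∃ t ∈ S, t • a • x = 0 := fun a ha => by
    have := hz _ (Ideal.mem_map_of_mem _ ha)
    rw [algebraMap_smul, LocalizedModule.smul'_mk, ← LocalizedModule.zero_mk 1,
      LocalizedModule.mk_eq] at this
    obtain ⟨u, hu⟩ := this
    exact ⟨u, u.2, by simpa [Submonoid.smul_def] using hu⟩
  obtain ⟨t, ht, htx⟩ := exists_forall_smul_smul_eq_zero 𝔞 S x this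
  refine ⟨t • x, (mem_ann 𝔞).2 fun a ha => ?_, ⟨t, ht⟩ * s, ?_⟩
  · rw [smul_comm]
    exact htx a ha
  · rw [← IsLocalizedModule.mk_eq_mk']
    exact LocalizedModule.mk_cancel_common_left ⟨t, ht⟩ s x

lemma isArtinian_ann_localized {X : Type u} [AddCommGroup X] [Module R X] (hT : IsTors 𝔞 X)
    (hfin : Module.Finite R (ann 𝔞 X)) (hdim : SuppDimLEOne R X) (S : Submonoid R)
    (hS : ∀ s, s ∈ S ↔ ∀ p ∈ Module.support R X, ¬ p.asIdeal.IsMaximal → s ∉ p.asIdeal) :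
    IsArtinian (Localization S) ((ann 𝔞 X).localized S) := by
  have hloc : Module.Finite (Localization S) ((ann 𝔞 X).localized S) :=
    Module.Finite.iff_fg.2 (Submodule.localized_fg S (Module.Finite.iff_fg.1 hfin))
  have : IsNoetherianRing (Localization S) := IsLocalization.isNoetherianRing S _ inferInstance
  have key : ∀ P : Ideal (Localization S), P.IsPrime →
      Module.annihilator (Localization S) ((ann 𝔞 X).localized S) ≤ P →
      ∃ p ∈ Module.support R X, ¬ p.asIdeal.IsMaximal ∧ p.asIdeal = P.under R := by
    intro P hP hle
    have hprime : (P.under R).IsPrime := inferInstance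
    have hdisj := (IsLocalization.disjoint_under_iff S (Localization S) P).2 hP.ne_top
    have hsub : ((P.under R : Ideal R) : Set R) ⊆
        ⋃ p ∈ {p ∈ Module.support R X | ¬ p.asIdeal.IsMaximal}, (p.asIdeal : Set R) := by
      intro r hr
      by_contra hn
      refine Set.disjoint_right.1 hdisj hr ((hS r).2 fun p hp hmax hrp => hn ?_)
      exact Set.mem_biUnion (show p ∈ {p ∈ Module.support R X | ¬ p.asIdeal.IsMaximal} from
        ⟨hp, hmax⟩) hrp
    obtain ⟨p, ⟨hp, hmax⟩, hle'⟩ := (Ideal.subset_union_prime_finite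
      (finite_nonmaximal_support hT hfin hdim) (f := PrimeSpectrum.asIdeal) ⟨_, hprime⟩ ⟨_, hprime⟩
      (fun p _ _ _ => p.isPrime)).1 hsub
    refine ⟨p, hp, hmax, ?_⟩
    have hmem : (⟨P.under R, hprime⟩ : PrimeSpectrum R) ∈ Module.support R X := by
      rw [← hT.support_ann]
      refine Module.mem_support_iff_of_finite.2 fun r hr => hle ?_
      refine Module.mem_annihilator.2 fun z => ?_
      obtain ⟨_, m, hm, s, rfl⟩ := z
      ext
      change algebraMap R (Localization S) r • IsLocalizedModule.mk' _ m s = 0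
      have h0 : r • m = 0 := congrArg Subtype.val (Module.mem_annihilator.1 hr ⟨m, hm⟩)
      rw [algebraMap_smul, ← IsLocalizedModule.mk'_smul, h0, IsLocalizedModule.mk'_zero]
    by_contra hne
    exact hmax (hdim _ hmem p (lt_of_le_of_ne hle' fun h =>
      hne (congrArg PrimeSpectrum.asIdeal h).symm))
  refine isArtinian_of_isMaximal fun P hP hle => ?_
  obtain ⟨Q, hQ, hPQ⟩ := Ideal.exists_le_maximal P hP.ne_top
  obtain ⟨p, hp, hpm, hpP⟩ := key P hP hle
  obtain ⟨q, hq, hqm, hqQ⟩ := key Q hQ.isPrime (hle.trans hPQ)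
  have hpq : p ≤ q := by
    change p.asIdeal ≤ q.asIdeal
    rw [hpP, hqQ]
    exact Ideal.comap_mono hPQ
  have : p = q := by
    by_contra hne
    exact hqm (hdim p hp q (lt_of_le_of_ne hpq hne))
  subst this
  have : P = Q := by
    rw [← IsLocalization.map_under S (Localization S) P, ← hpP, hqQ, IsLocalization.map_under S]
  exact this ▸ hQ

lemma exists_fg_quotient {X : Type u} [AddCommGroup X] [Module R X] (hT : IsTors 𝔞 X)
    (hfin : Module.Finite R (ann 𝔞 X)) (hdim : SuppDimLEOne R X) :
    ∃ x ∈ 𝔞, ∃ N : Submodule R (X ⧸ LinearMap.range (LinearMap.lsmul R X x)), N.FG ∧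
      ∀ c : X ⧸ LinearMap.range (LinearMap.lsmul R X x), ∃ s : R,
        (∀ p ∈ Module.support R X, ¬ p.asIdeal.IsMaximal → s ∉ p.asIdeal) ∧
        s • c ∈ N := by
  classical
  let S : Submonoid R :=
    { carrier := {s | ∀ p ∈ Module.support R X, ¬ p.asIdeal.IsMaximal → s ∉ p.asIdeal}
      mul_mem' := fun ha hb p hp hm => p.isPrime.mul_notMem (ha p hp hm) (hb p hp hm)
      one_mem' := fun p _ _ => p.isPrime.one_notMem }
  let A := Localization S
  have : IsNoetherianRing A := IsLocalization.isNoetherianRing S _ inferInstance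
  have hart := isArtinian_ann_localized hT hfin hdim S fun s => Iff.rfl
  have hloc : Module.Finite A ((ann 𝔞 X).localized S) :=
    Module.Finite.iff_fg.2 (Submodule.localized_fg S (Module.Finite.iff_fg.1 hfin))
  have hle := ann_localizedModule_le (𝔞 := 𝔞) (X := X) S
  have hincl := Submodule.inclusion_injective hle
  obtain ⟨-, x', hx', hfg⟩ := IsTors.extFinite_of_isArtinian (R := A)
    (𝔞 := 𝔞.map (algebraMap R A)) ⊥ (LocalizedModule S X)
    (by
      intro r hr z
      rw [(Submodule.mem_bot A).1 hr, zero_smul]) (hT.localizedModule S)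
    (Module.Finite.of_injective _ hincl) (isArtinian_of_injective _ hincl)
  obtain ⟨⟨⟨x, hx⟩, t⟩, hxt⟩ := (IsLocalization.mem_map_algebraMap_iff S A).1 hx'
  replace hxt : x' * algebraMap R A t = algebraMap R A x := hxt
  refine ⟨x, hx, ?_⟩
  let V := LinearMap.range (LinearMap.lsmul A (LocalizedModule S X) x')
  obtain ⟨G, hG⟩ := hfg.1
  choose g hg using fun c : LocalizedModule S X ⧸ V => V.mkQ_surjective c
  choose y s hys using fun z : LocalizedModule S X =>
    LocalizedModule.induction_on (β := fun z => ∃ y s, z = LocalizedModule.mk y s)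
      (fun y s => ⟨y, s, rfl⟩) z
  let N₀ : Submodule R X := Submodule.span R (G.image fun c => y (g c))
  let P : Submodule R X := N₀ ⊔ LinearMap.range (LinearMap.lsmul R X x)
  have hunit : IsUnit (algebraMap R A t) := IsLocalization.map_units A t
  have hV : V ≤ P.localized S := by
    rintro _ ⟨z, rfl⟩
    obtain ⟨u, hu⟩ := hunit
    have : LinearMap.lsmul A (LocalizedModule S X) x' z
        = (↑u⁻¹ : A) • algebraMap R A x • z := by
      rw [← hxt, ← hu, mul_comm, mul_smul, smul_smul, Units.inv_mul, one_smul]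
      rfl
    rw [this]
    refine Submodule.smul_mem _ _ ?_
    rw [hys z, algebraMap_smul, LocalizedModule.smul'_mk]
    exact ⟨x • y z, Submodule.mem_sup_right ⟨y z, rfl⟩, s z,
      (IsLocalizedModule.mk_eq_mk' _ _).symm⟩
  have htop : P.localized S = ⊤ := by
    have : Submodule.map V.mkQ (P.localized S) = ⊤ := by
      refine top_le_iff.1 (hG ▸ Submodule.span_le.2 fun c hc => ⟨g c, ?_, hg c⟩)
      rw [hys (g c)]
      exact ⟨y (g c), Submodule.mem_sup_left (Submodule.subset_span (by
        exact Finset.mem_coe.2 (Finset.mem_image_of_mem _ hc))), s (g c),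
        (IsLocalizedModule.mk_eq_mk' _ _).symm⟩
    have h2 := congrArg (Submodule.comap V.mkQ) this
    rwa [Submodule.comap_map_mkQ, Submodule.comap_top, sup_eq_right.2 hV] at h2
  refine ⟨N₀.map (Submodule.mkQ _), Submodule.FG.map _ ⟨_, rfl⟩, fun c => ?_⟩
  obtain ⟨c, rfl⟩ := Submodule.mkQ_surjective _ c
  obtain ⟨m, hm, s', h⟩ := (htop ▸ trivial : LocalizedModule.mk c 1 ∈ P.localized S)
  rw [← IsLocalizedModule.mk_eq_mk', LocalizedModule.mk_eq] at h
  obtain ⟨v, hv⟩ := h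
  have hmem : ((v * s' : S) : R) • c ∈ P := by
    have : ((v * s' : S) : R) • c = (v : R) • m := by
      simp only [Submonoid.smul_def, one_smul] at hv
      rw [hv, Submonoid.coe_mul, mul_smul]
    rw [this]
    exact P.smul_mem _ hm
  refine ⟨_, (v * s').2, ?_⟩
  rw [← map_smul]
  obtain ⟨a, ha, b, hb, hab⟩ := Submodule.mem_sup.1 hmem
  refine ⟨a, ha, ?_⟩
  have hb0 : Submodule.mkQ (LinearMap.range (LinearMap.lsmul R X x)) b = 0 :=
    (Submodule.Quotient.mk_eq_zero _).2 hb
  rw [← hab, map_add, hb0, add_zero]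

end One

lemma suppDimLEOne_of_krullDim_lt {R : Type u} [CommRing R] {X : Type*}
    [AddCommGroup X] [Module R X]
    (h : Order.krullDim (Module.support R X) < ((2 : ℕ∞) : WithBot ℕ∞)) : SuppDimLEOne R X := by
  intro p hp q hpq
  by_contra hmax
  obtain ⟨m, hm, hqm⟩ := Ideal.exists_le_maximal q.asIdeal q.isPrime.ne_top
  let M : PrimeSpectrum R := ⟨m, hm.isPrime⟩
  have hqM : q < M := lt_of_le_of_ne hqm fun h => hmax (by rw [h]; exact hm)
  have hq := Module.mem_support_mono hpq.le hp
  have hM := Module.mem_support_mono hqM.le hq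
  let l : LTSeries (Module.support R X) :=
    { length := 2
      toFun := ![⟨p, hp⟩, ⟨q, hq⟩, ⟨M, hM⟩]
      step := fun i => by
        fin_cases i
        · exact hpq
        · exact hqM }
  have h2 := Order.LTSeries.length_le_krullDim l
  exact absurd (lt_of_le_of_lt h2 h) (lt_irrefl _)

section FD
variable {R : Type u} [CommRing R] [IsNoetherianRing R] {𝔞 : Ideal R}

/-- If `X` is `𝔞`-torsion of dimension at most one and `Ext^i(R/𝔞, X)` is finitely generated for
`i ≤ 1`, then `X` is `𝔞`-cofinite. -/
lemma IsTors.extFinite_of_suppDimLEOne (J : Ideal R) : ∀ (X : Type u) [AddCommGroup X] [Module R X],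
    (∀ r ∈ J, ∀ x : X, r • x = 0) → IsTors 𝔞 X → SuppDimLEOne R X → ExtFinite 𝔞 X 0 →
    ExtFinite 𝔞 X 1 → ∀ i, ExtFinite 𝔞 X i := by
  induction J using IsNoetherian.induction with
  | _ J ih =>
  intro X _ _ hJ hT hdim h0 h1
  obtain ⟨x, hx, N, hN, hNs⟩ := exists_fg_quotient hT ((extFinite_zero_iff 𝔞).1 h0) hdim
  let f := LinearMap.lsmul R X x
  let I := LinearMap.range f
  let K := LinearMap.ker f
  have hC : ExtFinite 𝔞 (X ⧸ I) 0 → ∀ i, ExtFinite 𝔞 (X ⧸ I) i := by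
    intro hC0
    have hNfin : Module.Finite R N := Module.Finite.iff_fg.2 hN
    have hex : Function.Exact N.subtype N.mkQ := LinearMap.exact_subtype_mkQ N
    have hD0 : ExtFinite 𝔞 ((X ⧸ I) ⧸ N) 0 := ExtFinite.right 𝔞 N.subtype_injective
      N.mkQ_surjective hex hC0 (ExtFinite.of_finite 𝔞 1)
    have hDfin := (extFinite_zero_iff 𝔞).1 hD0
    have hTD : IsTors 𝔞 ((X ⧸ I) ⧸ N) :=
      (hT.of_surjective I.mkQ I.mkQ_surjective).of_surjective N.mkQ N.mkQ_surjective
    have hart : IsArtinian R (ann 𝔞 ((X ⧸ I) ⧸ N)) := by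
      refine isArtinian_of_isMaximal fun p hp hle => ?_
      have hmem : (⟨p, hp⟩ : PrimeSpectrum R) ∈ Module.support R ((X ⧸ I) ⧸ N) :=
        Module.support_subset_of_injective _ (Submodule.subtype_injective _)
          (Module.mem_support_iff_of_finite.2 hle)
      by_contra hmax
      obtain ⟨d, hd⟩ := Module.mem_support_iff'.1 hmem
      obtain ⟨c, rfl⟩ := N.mkQ_surjective d
      obtain ⟨s, hs, hsc⟩ := hNs c
      refine hd s (hs ⟨p, hp⟩ ?_ hmax) ?_
      · exact Module.support_subset_of_surjective _ I.mkQ_surjective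
          (Module.support_subset_of_surjective _ N.mkQ_surjective hmem)
      · rw [← map_smul]
        exact (Submodule.Quotient.mk_eq_zero _).2 hsc
    have hD := (IsTors.extFinite_of_isArtinian (𝔞 := 𝔞) ⊥ _ (fun r hr z => by
      rw [(Submodule.mem_bot R).1 hr, zero_smul]) hTD hDfin hart).1
    exact fun i => ExtFinite.middle 𝔞 N.subtype_injective N.mkQ_surjective hex
      (ExtFinite.of_finite 𝔞 i) (hD i)
  by_cases hxJ : x ∈ J
  · have hI : I = ⊥ := by
      refine (Submodule.eq_bot_iff _).2 ?_
      rintro _ ⟨y, rfl⟩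
      exact hJ x hxJ y
    let e : (X ⧸ I) ≃ₗ[R] X := Submodule.quotEquivOfEqBot I hI
    exact fun i => ExtFinite.of_linearEquiv 𝔞 e (hC (ExtFinite.of_linearEquiv 𝔞 e.symm h0) i)
  · have hlt : J < J ⊔ Ideal.span {x} := lt_of_le_of_ne le_sup_left fun h =>
      hxJ (h ▸ Ideal.mem_sup_right (Ideal.mem_span_singleton_self x))
    have hexK : Function.Exact K.subtype f.rangeRestrict := by
      intro y
      simp [Subtype.ext_iff, K]
    have hI0 : ExtFinite 𝔞 I 0 := ExtFinite.zero_of_injective 𝔞 I.subtype_injective h0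
    have hK1 : ExtFinite 𝔞 K 1 := ExtFinite.left 𝔞 K.subtype_injective f.surjective_rangeRestrict
      hexK hI0 h1
    have hK : ∀ i, ExtFinite 𝔞 K i := by
      refine ih _ hlt K ?_ (hT.of_injective K.subtype K.subtype_injective)
        (fun p hp => hdim p (Module.support_subset_of_injective _ K.subtype_injective hp))
        (ExtFinite.zero_of_injective 𝔞 K.subtype_injective h0) hK1
      intro r hr y
      obtain ⟨a, ha, b, hb, rfl⟩ := Submodule.mem_sup.1 hr
      obtain ⟨c, rfl⟩ := Ideal.mem_span_singleton'.1 hb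
      rw [add_smul, mul_smul]
      have h1 : a • y = 0 := Subtype.ext (hJ a ha y)
      have h2 : x • y = 0 := Subtype.ext y.2
      rw [h1, h2, smul_zero, add_zero]
    have hI1 : ExtFinite 𝔞 I 1 := ExtFinite.right 𝔞 K.subtype_injective
      f.surjective_rangeRestrict hexK h1 (hK 2)
    have hC0 : ExtFinite 𝔞 (X ⧸ I) 0 := ExtFinite.right 𝔞 I.subtype_injective I.mkQ_surjective
      (LinearMap.exact_subtype_mkQ I) h0 hI1
    exact ExtFinite.of_ker_coker 𝔞 hx hK (hC hC0)

/-- An `𝔞`-torsion `FD_{<2}` module `X` with `Ext^i(R/𝔞, X)` finitely generated for `i ≤ 1` is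
`𝔞`-cofinite. -/
lemma IsTors.extFinite_of_isFDLT {X : Type u} [AddCommGroup X] [Module R X] (hT : IsTors 𝔞 X)
    (hX : IsFDLT R 2 X) (h0 : ExtFinite 𝔞 X 0) (h1 : ExtFinite 𝔞 X 1) (i : ℕ) :
    ExtFinite 𝔞 X i := by
  obtain ⟨N, hN, hdim⟩ := hX
  have hNfin : Module.Finite R N := Module.Finite.iff_fg.2 hN
  have hex : Function.Exact N.subtype N.mkQ := LinearMap.exact_subtype_mkQ N
  have hQ (i : ℕ) (hi : ExtFinite 𝔞 X i) : ExtFinite 𝔞 (X ⧸ N) i :=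
    ExtFinite.right 𝔞 N.subtype_injective N.mkQ_surjective hex hi (ExtFinite.of_finite 𝔞 _)
  exact ExtFinite.middle 𝔞 N.subtype_injective N.mkQ_surjective hex (ExtFinite.of_finite 𝔞 i)
    (IsTors.extFinite_of_suppDimLEOne ⊥ (X ⧸ N) (fun r hr z => by
      rw [(Submodule.mem_bot R).1 hr, zero_smul]) (hT.of_surjective N.mkQ N.mkQ_surjective)
      (suppDimLEOne_of_krullDim_lt hdim) (hQ 0 h0) (hQ 1 h1) i)

end FD

section OpComplex
open HomologicalComplex
variable {R : Type u} [CommRing R] (K : ChainComplex (ModuleCat.{u} R)ᵒᵖ ℕ) (n : ℕ)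

lemma pOpcycles_unop_injective : Function.Injective (K.pOpcycles n).unop.hom :=
  (ModuleCat.mono_iff_injective _).1 inferInstance

lemma homologyι_unop_surjective : Function.Surjective (K.homologyι n).unop.hom :=
  (ModuleCat.epi_iff_surjective _).1 inferInstance

lemma pOpcycles_unop_exact :
    Function.Exact (K.pOpcycles n).unop.hom (K.d (n + 1) n).unop.hom := by
  have h := (ShortComplex.exact_of_g_is_cokernel (ShortComplex.mk (K.d (n + 1) n) (K.pOpcycles n)
    (by simp)) (K.opcyclesIsCokernel (n + 1) n (by simp))).unop
  exact (ShortComplex.ShortExact.moduleCat_exact_iff_function_exact _).1 h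

lemma homologyι_unop_exact (j : ℕ) (hj : (ComplexShape.down ℕ).next n = j) :
    Function.Exact (K.fromOpcycles n j).unop.hom (K.homologyι n).unop.hom := by
  have h := (ShortComplex.exact_of_f_is_kernel (ShortComplex.mk (K.homologyι n)
    (K.fromOpcycles n j) (by simp)) (K.homologyIsKernel n j hj)).unop
  exact (ShortComplex.ShortExact.moduleCat_exact_iff_function_exact _).1 h

lemma pOpcycles_unop_fromOpcycles_unop (j : ℕ) (v : (K.X j).unop) :
    (K.pOpcycles n).unop.hom ((K.fromOpcycles n j).unop.hom v) = (K.d n j).unop.hom v := by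
  rw [← K.p_fromOpcycles n j]
  rfl

end OpComplex

section ExtMk
open ProjectiveResolution
variable {R : Type u} [CommRing R] {X Y : ModuleCat.{u} R} (P : ProjectiveResolution X)

lemma extMk_zero_eq_zero_iff (f : P.complex.X 0 ⟶ Y) (hf : P.complex.d 1 0 ≫ f = 0) :
    P.extMk f 1 rfl hf = 0 ↔ f = 0 := by
  simp only [← P.extEquivCohomologyClass.apply_eq_iff_eq,
    extEquivCohomologyClass_extMk, extEquivCohomologyClass_zero,
    CochainComplex.HomComplex.CohomologyClass.mk_eq_zero_iff]
  rw [CochainComplex.HomComplex.Cocycle.toSingleMk_mem_coboundaries_iff _ _ _ _ _ 1 (by simp)]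
  have hz : Limits.IsZero (P.cochainComplex.X 1) :=
    P.cochainComplex.isZero_of_isStrictlyLE 0 1 (by norm_num)
  constructor
  · rintro ⟨g, hg⟩
    rw [hz.eq_of_src g 0, Limits.comp_zero] at hg
    rw [← cancel_epi (P.cochainComplexXIso (-(0 : ℕ)) 0 rfl).hom, ← hg, Limits.comp_zero]
  · rintro rfl
    exact ⟨0, by simp⟩

lemma extMk_eq_zero_iff_next {n : ℕ} (f : P.complex.X n ⟶ Y) (hf : P.complex.d (n + 1) n ≫ f = 0) :
    P.extMk f (n + 1) rfl hf = 0 ↔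
      ∃ g : P.complex.X ((ComplexShape.down ℕ).next n) ⟶ Y, P.complex.d n _ ≫ g = f := by
  cases n with
  | zero =>
    rw [extMk_zero_eq_zero_iff]
    simp [eq_comm]
  | succ p =>
    have e : (ComplexShape.down ℕ).next (p + 1) = p := by simp
    rw [e]
    exact P.extMk_eq_zero_iff f _ rfl hf p rfl

/-- The cocycles of degree `n` in the complex computing `Ext` from a projective resolution. -/
def cocycles (n : ℕ) (Y : ModuleCat.{u} R) : Submodule R (P.complex.X n ⟶ Y) :=
  LinearMap.ker (Linear.leftComp R Y (P.complex.d (n + 1) n))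

variable {P} in
lemma mem_cocycles {n : ℕ} {f : P.complex.X n ⟶ Y} :
    f ∈ cocycles P n Y ↔ P.complex.d (n + 1) n ≫ f = 0 := by
  simp [cocycles]

/-- The linear map sending a cocycle to its class in `Ext`. -/
noncomputable def extMkLinear (n : ℕ) (Y : ModuleCat.{u} R) :
    cocycles P n Y →ₗ[R] Abelian.Ext X Y n where
  toFun f := P.extMk f.1 (n + 1) rfl (mem_cocycles.1 f.2)
  map_add' f g := (P.add_extMk _ _ _ _ _ _).symm
  map_smul' r f := by
    rw [RingHom.id_apply, Abelian.Ext.smul_eq_comp_mk₀, P.extMk_comp_mk₀]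
    congr 1

lemma extMkLinear_surjective (n : ℕ) : Function.Surjective (extMkLinear P n Y) := fun α => by
  obtain ⟨f, hf, rfl⟩ := P.extMk_surjective α (n + 1) rfl
  exact ⟨⟨f, mem_cocycles.2 hf⟩, rfl⟩

end ExtMk

section Comparison
open ProjectiveResolution HomologicalComplex
variable {R : Type u} [CommRing R] {X X' : ModuleCat.{u} R} (P : ProjectiveResolution X)
  (P' : ProjectiveResolution X') (n : ℕ) (Y : ModuleCat.{u} R)

/-- The complex of modules `Hom(P, Y)`, seen in the opposite category. -/
noncomputable abbrev homComplex : ChainComplex (ModuleCat.{u} R)ᵒᵖ ℕ :=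
  ((((linearYoneda R (ModuleCat.{u} R)).obj Y).rightOp).mapHomologicalComplex _).obj P.complex

/-- The module `Ext^n(X, Y)` defined through derived functors. -/
noncomputable abbrev extObj (n : ℕ) (X Y : ModuleCat.{u} R) : ModuleCat.{u} R :=
  ((Ext R (ModuleCat.{u} R) n).obj (Opposite.op X)).obj Y

/-- The inclusion of the cocycles in `Hom(P_n, Y)`. -/
noncomputable def cocycleVal : ((homComplex P Y).opcycles n).unop →ₗ[R] (P.complex.X n ⟶ Y) :=
  ((homComplex P Y).pOpcycles n).unop.hom

/-- The computation of the left derived functor of `Hom(-, Y)` using a projective resolution. -/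
noncomputable def leftDerivedIso :
    (((linearYoneda R (ModuleCat.{u} R)).obj Y).rightOp.leftDerived n).obj X ≅
      (homComplex P Y).homology n :=
  P.isoLeftDerivedObj ((linearYoneda R (ModuleCat.{u} R)).obj Y).rightOp n

/-- The projection from the cocycles to the derived functor `Ext`. -/
noncomputable def cocycleClass : ((homComplex P Y).opcycles n).unop →ₗ[R] extObj n X Y :=
  ((leftDerivedIso P n Y).hom ≫ (homComplex P Y).homologyι n).unop.hom

lemma cocycleVal_mem (w : ((homComplex P Y).opcycles n).unop) :
    cocycleVal P n Y w ∈ cocycles P n Y :=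
  mem_cocycles.2 ((pOpcycles_unop_exact (homComplex P Y) n _).2 ⟨w, rfl⟩)

lemma exists_cocycleVal_eq {f : P.complex.X n ⟶ Y} (hf : f ∈ cocycles P n Y) :
    ∃ w, cocycleVal P n Y w = f :=
  (pOpcycles_unop_exact (homComplex P Y) n f).1 (mem_cocycles.1 hf)

lemma cocycleClass_surjective : Function.Surjective (cocycleClass P n Y) := by
  have h := homologyι_unop_surjective (homComplex P Y) n
  have h2 : Function.Surjective (leftDerivedIso P n Y).hom.unop.hom :=
    (ModuleCat.epi_iff_surjective _).1 inferInstance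
  exact h2.comp h

lemma cocycleClass_eq_zero_iff (w : ((homComplex P Y).opcycles n).unop) :
    cocycleClass P n Y w = 0 ↔ ∃ g : P.complex.X ((ComplexShape.down ℕ).next n) ⟶ Y,
      P.complex.d n _ ≫ g = cocycleVal P n Y w := by
  have h2 : Function.Injective (leftDerivedIso P n Y).hom.unop.hom :=
    (ModuleCat.mono_iff_injective _).1 inferInstance
  have h3 : cocycleClass P n Y w = 0 ↔ ((homComplex P Y).homologyι n).unop.hom w = 0 :=
    map_eq_zero_iff _ h2
  rw [h3, homologyι_unop_exact (homComplex P Y) n _ rfl]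
  constructor
  · rintro ⟨g, rfl⟩
    exact ⟨g, (pOpcycles_unop_fromOpcycles_unop (homComplex P Y) n _ g).symm⟩
  · rintro ⟨g, hg⟩
    exact ⟨g, pOpcycles_unop_injective (homComplex P Y) n
      ((pOpcycles_unop_fromOpcycles_unop (homComplex P Y) n _ g).trans hg)⟩

/-- The projection from the cocycles to `Ext` computed in the derived category. -/
noncomputable def cocycleClass' :
    ((homComplex P Y).opcycles n).unop →ₗ[R] Abelian.Ext X Y n :=
  (extMkLinear P n Y).comp ((cocycleVal P n Y).codRestrict _ (cocycleVal_mem P n Y))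

lemma cocycleClass'_apply (w : ((homComplex P Y).opcycles n).unop) :
    cocycleClass' P n Y w =
      P.extMk (cocycleVal P n Y w) (n + 1) rfl (mem_cocycles.1 (cocycleVal_mem P n Y w)) := rfl

lemma cocycleClass'_surjective : Function.Surjective (cocycleClass' P n Y) := fun α => by
  obtain ⟨f, rfl⟩ := extMkLinear_surjective P n α
  obtain ⟨w, hw⟩ := exists_cocycleVal_eq P n Y f.2
  exact ⟨w, congrArg (extMkLinear P n Y) (Subtype.ext hw)⟩

lemma ker_cocycleClass :
    LinearMap.ker (cocycleClass P n Y) = LinearMap.ker (cocycleClass' P n Y) := by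
  ext w
  rw [LinearMap.mem_ker, LinearMap.mem_ker, cocycleClass_eq_zero_iff, cocycleClass'_apply,
    extMk_eq_zero_iff_next]

/-- The comparison between the two definitions of `Ext`. -/
noncomputable def extEquivOfResolution : extObj n X Y ≃ₗ[R] Abelian.Ext X Y n :=
  ((cocycleClass P n Y).quotKerEquivOfSurjective (cocycleClass_surjective P n Y)).symm ≪≫ₗ
    Submodule.quotEquivOfEq _ _ (ker_cocycleClass P n Y) ≪≫ₗ
    (cocycleClass' P n Y).quotKerEquivOfSurjective (cocycleClass'_surjective P n Y)

lemma extEquivOfResolution_apply (w : ((homComplex P Y).opcycles n).unop) :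
    extEquivOfResolution P n Y (cocycleClass P n Y w) = cocycleClass' P n Y w := by
  have h : ((cocycleClass P n Y).quotKerEquivOfSurjective (cocycleClass_surjective P n Y)).symm
      (cocycleClass P n Y w) = Submodule.Quotient.mk w := by
    rw [LinearEquiv.symm_apply_eq]; rfl
  simp only [extEquivOfResolution, LinearEquiv.trans_apply, h]
  rfl

variable {P P'} in
lemma extEquivOfResolution_naturality {f : X ⟶ X'} (φ : Hom P P' f)
    (x : extObj n X' Y) :
    extEquivOfResolution P n Y
      ((((Ext R (ModuleCat.{u} R) n).map f.op).app Y).hom x) =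
    (Abelian.Ext.mk₀ f).comp (extEquivOfResolution P' n Y x) (zero_add n) := by
  obtain ⟨w, rfl⟩ := cocycleClass_surjective P' n Y x
  let Φ : homComplex P Y ⟶ homComplex P' Y :=
    ((((linearYoneda R (ModuleCat.{u} R)).obj Y).rightOp).mapHomologicalComplex _).map φ.hom
  have hcomm : (((linearYoneda R (ModuleCat.{u} R)).obj Y).rightOp.leftDerived n).map f ≫
      (leftDerivedIso P' n Y).hom = (leftDerivedIso P n Y).hom ≫ homologyMap Φ n :=
    P.isoLeftDerivedObj_hom_naturality f P' φ.hom φ.hom_f_zero_comp_π_f_zero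
      ((linearYoneda R (ModuleCat.{u} R)).obj Y).rightOp n
  let w' : ((homComplex P Y).opcycles n).unop := (opcyclesMap Φ n).unop.hom w
  have h1 : (((Ext R (ModuleCat.{u} R) n).map f.op).app Y).hom (cocycleClass P' n Y w) =
      cocycleClass P n Y w' := by
    have : (((linearYoneda R (ModuleCat.{u} R)).obj Y).rightOp.leftDerived n).map f ≫
        (leftDerivedIso P' n Y).hom ≫ (homComplex P' Y).homologyι n =
        ((leftDerivedIso P n Y).hom ≫ (homComplex P Y).homologyι n) ≫ opcyclesMap Φ n := by
      rw [Category.assoc, ← homologyι_naturality, reassoc_of% hcomm]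
    exact congrArg (fun g => g.unop.hom w) this
  have h2 : cocycleVal P n Y w' = φ.hom.f n ≫ cocycleVal P' n Y w := by
    have : (homComplex P Y).pOpcycles n ≫ opcyclesMap Φ n = Φ.f n ≫ (homComplex P' Y).pOpcycles n :=
      p_opcyclesMap Φ n
    exact congrArg (fun g => g.unop.hom w) this
  rw [h1, extEquivOfResolution_apply, extEquivOfResolution_apply, cocycleClass'_apply,
    cocycleClass'_apply, mk₀_comp_extMk _ _ _ _ φ]
  congr 1

/-- The comparison between the two definitions of `Ext`. -/
noncomputable def extEquiv (n : ℕ) (X Y : ModuleCat.{u} R) :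
    extObj n X Y ≃ₗ[R] Abelian.Ext X Y n :=
  extEquivOfResolution (projectiveResolution X) n Y

lemma extEquiv_naturality {X X' : ModuleCat.{u} R} (f : X ⟶ X') (n : ℕ) (Y : ModuleCat.{u} R)
    (x : extObj n X' Y) :
    extEquiv n X Y ((((Ext R (ModuleCat.{u} R) n).map f.op).app Y).hom x) =
    (Abelian.Ext.mk₀ f).comp (extEquiv n X' Y x) (zero_add n) :=
  extEquivOfResolution_naturality n Y
    { hom := lift f _ _
      hom_f_zero_comp_π_f_zero := lift_commutes_zero _ _ _ } x

end Comparison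

section LocCoh
variable {R : Type u} [CommRing R] (𝔞 : Ideal R)

/-- The module `R/𝔞^n`. -/
abbrev quotPow (n : ℕ) : ModuleCat.{u} R := ModuleCat.of R (R ⧸ 𝔞 ^ n)

/-- The projection `R/𝔞^m → R/𝔞^n` for `n ≤ m`. -/
def quotPowMap {n m : ℕ} (h : n ≤ m) : quotPow 𝔞 m ⟶ quotPow 𝔞 n :=
  ModuleCat.ofHom (Submodule.mapQ _ _ LinearMap.id (Ideal.pow_le_pow_right h))

@[simp]
lemma quotPowMap_self (n : ℕ) : quotPowMap 𝔞 (le_refl n) = 𝟙 _ :=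
  ModuleCat.hom_ext (Submodule.mapQ_id _)

lemma quotPowMap_comp {n m k : ℕ} (h : n ≤ m) (h' : m ≤ k) :
    quotPowMap 𝔞 h' ≫ quotPowMap 𝔞 h = quotPowMap 𝔞 (h.trans h') := by
  ext
  rfl

/-- The transition maps of the system `Ext^i(R/𝔞^n, X)`. -/
noncomputable def extRes (X : ModuleCat.{u} R) (i : ℕ) {n m : ℕ} (h : n ≤ m) :
    Abelian.Ext (quotPow 𝔞 n) X i →ₗ[R] Abelian.Ext (quotPow 𝔞 m) X i :=
  (Abelian.Ext.mk₀ (quotPowMap 𝔞 h)).precompOfLinear R X (zero_add i)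

lemma extRes_apply (X : ModuleCat.{u} R) (i : ℕ) {n m : ℕ} (h : n ≤ m)
    (x : Abelian.Ext (quotPow 𝔞 n) X i) :
    extRes 𝔞 X i h x = (Abelian.Ext.mk₀ (quotPowMap 𝔞 h)).comp x (zero_add i) := rfl

lemma extRes_self (X : ModuleCat.{u} R) (i : ℕ) {n : ℕ} (x : Abelian.Ext (quotPow 𝔞 n) X i) :
    extRes 𝔞 X i le_rfl x = x := by
  rw [extRes_apply, quotPowMap_self, Abelian.Ext.mk₀_id_comp]

lemma extRes_extRes (X : ModuleCat.{u} R) (i : ℕ) {n m k : ℕ} (h : n ≤ m) (h' : m ≤ k)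
    (x : Abelian.Ext (quotPow 𝔞 n) X i) :
    extRes 𝔞 X i h' (extRes 𝔞 X i h x) = extRes 𝔞 X i (h.trans h') x := by
  rw [extRes_apply, extRes_apply, extRes_apply, Abelian.Ext.mk₀_comp_mk₀_assoc, quotPowMap_comp]

lemma extRes_comp {X Y : ModuleCat.{u} R} {i j k : ℕ} {n m : ℕ} (h : n ≤ m)
    (x : Abelian.Ext (quotPow 𝔞 n) X i) (y : Abelian.Ext X Y j) (hk : i + j = k) :
    extRes 𝔞 Y k h (x.comp y hk) = (extRes 𝔞 X i h x).comp y hk := by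
  rw [extRes_apply, extRes_apply, Abelian.Ext.comp_assoc _ _ _ _ _ (by omega)]

/-- Data exhibiting `H` as the colimit of the modules `Ext^i(R/𝔞^n, X)`. -/
structure LocCoh (X : ModuleCat.{u} R) (i : ℕ) (H : Type u) [AddCommGroup H] [Module R H] where
  /-- The maps to the colimit. -/
  ι (n : ℕ) : Abelian.Ext (quotPow 𝔞 n) X i →ₗ[R] H
  ι_res {n m : ℕ} (h : n ≤ m) (x : Abelian.Ext (quotPow 𝔞 n) X i) :
    ι m (extRes 𝔞 X i h x) = ι n x
  exists_rep (y : H) : ∃ n x, ι n x = y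
  exists_res_eq_zero {n : ℕ} (x : Abelian.Ext (quotPow 𝔞 n) X i) (hx : ι n x = 0) :
    ∃ m, ∃ h : n ≤ m, extRes 𝔞 X i h x = 0

variable {𝔞} {X : ModuleCat.{u} R} {i : ℕ} {H H' : Type u} [AddCommGroup H] [Module R H]
  [AddCommGroup H'] [Module R H']

variable (𝔞 X i) in
open Classical in
/-- The concrete direct limit of the modules `Ext^i(R/𝔞^n, X)`. -/
abbrev ExtLim : Type u :=
  Module.DirectLimit (R := R) (fun n => Abelian.Ext (quotPow 𝔞 n) X i)
    (fun _ _ h => extRes 𝔞 X i h)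

open Classical in
/-- The comparison map from the concrete direct limit. -/
noncomputable def LocCoh.desc (D : LocCoh 𝔞 X i H) : ExtLim 𝔞 X i →ₗ[R] H :=
  Module.DirectLimit.lift R ℕ (fun n => Abelian.Ext (quotPow 𝔞 n) X i)
    (fun _ _ h => extRes 𝔞 X i h) D.ι fun _ _ h x => D.ι_res h x

variable (𝔞 X i) in
open Classical in
/-- The maps to the concrete direct limit. -/
noncomputable def extLimOf (n : ℕ) : Abelian.Ext (quotPow 𝔞 n) X i →ₗ[R] ExtLim 𝔞 X i :=
  Module.DirectLimit.of R ℕ (fun n => Abelian.Ext (quotPow 𝔞 n) X i)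
    (fun _ _ h => extRes 𝔞 X i h) n

lemma LocCoh.desc_of (D : LocCoh 𝔞 X i H) (n : ℕ) (x : Abelian.Ext (quotPow 𝔞 n) X i) :
    D.desc (extLimOf 𝔞 X i n x) = D.ι n x := by
  classical
  exact Module.DirectLimit.lift_of D.ι (fun _ _ h x => D.ι_res h x) x

lemma extLimOf_res {n m : ℕ} (h : n ≤ m) (x : Abelian.Ext (quotPow 𝔞 n) X i) :
    extLimOf 𝔞 X i m (extRes 𝔞 X i h x) = extLimOf 𝔞 X i n x := by
  classical
  exact Module.DirectLimit.of_f (f := fun _ _ h => extRes 𝔞 X i h) (hij := h)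

lemma exists_extLimOf_eq (z : ExtLim 𝔞 X i) : ∃ n x, extLimOf 𝔞 X i n x = z := by
  classical
  exact Module.DirectLimit.exists_of z

lemma LocCoh.desc_bijective (D : LocCoh 𝔞 X i H) : Function.Bijective D.desc := by
  constructor
  · rw [injective_iff_map_eq_zero]
    intro z hz
    obtain ⟨n, x, rfl⟩ := exists_extLimOf_eq z
    rw [D.desc_of] at hz
    obtain ⟨m, h, hm⟩ := D.exists_res_eq_zero x hz
    rw [← extLimOf_res h, hm, map_zero]
  · intro y
    obtain ⟨n, x, rfl⟩ := D.exists_rep y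
    exact ⟨_, D.desc_of n x⟩

/-- The identification of `H` with the concrete direct limit. -/
noncomputable def LocCoh.equivDirectLimit (D : LocCoh 𝔞 X i H) : ExtLim 𝔞 X i ≃ₗ[R] H :=
  LinearEquiv.ofBijective D.desc D.desc_bijective

/-- The uniqueness of the colimit. -/
noncomputable def LocCoh.equiv (D : LocCoh 𝔞 X i H) (D' : LocCoh 𝔞 X i H') : H ≃ₗ[R] H' :=
  D.equivDirectLimit.symm.trans D'.equivDirectLimit

lemma ext_quot_smul_eq_zero (n : ℕ) (x : Abelian.Ext (quotPow 𝔞 n) X i) {r : R}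
    (hr : r ∈ 𝔞 ^ n) : r • x = 0 := by
  have h : r • 𝟙 (quotPow 𝔞 n) = 0 := by
    refine ModuleCat.hom_ext (LinearMap.ext fun y => ?_)
    obtain ⟨y, rfl⟩ := Submodule.Quotient.mk_surjective _ y
    change r • (Submodule.Quotient.mk y : R ⧸ 𝔞 ^ n) = 0
    rw [← Submodule.Quotient.mk_smul, Submodule.Quotient.mk_eq_zero]
    exact Ideal.mul_mem_right _ _ hr
  rw [← Abelian.Ext.mk₀_id_comp (r • x), Abelian.Ext.comp_smul, ← Abelian.Ext.smul_comp,
    ← Abelian.Ext.mk₀_smul, h, Abelian.Ext.mk₀_zero, Abelian.Ext.zero_comp]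

lemma LocCoh.isTors (D : LocCoh 𝔞 X i H) : IsTors 𝔞 H := fun y => by
  obtain ⟨n, x, rfl⟩ := D.exists_rep y
  exact ⟨n, fun r hr => by rw [← map_smul, ext_quot_smul_eq_zero n x hr, map_zero]⟩

end LocCoh

section LocalCohomology
open Limits
variable {R : Type u} [CommRing R] (𝔞 : Ideal R) (i : ℕ) (X : ModuleCat.{u} R)

/-- The diagram computing local cohomology. -/
noncomputable abbrev locCohDiagram : (ℕᵒᵖ)ᵒᵖ ⥤ ModuleCat.{u} R :=
  localCohomology.diagram (localCohomology.idealPowersDiagram 𝔞) i ⋙ (evaluation _ _).obj X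

/-- The colimit cocone with point the local cohomology module. -/
noncomputable def locCohCocone : Cocone (locCohDiagram 𝔞 i X) :=
  ((evaluation _ _).obj X).mapCocone
    (colimit.cocone (localCohomology.diagram (localCohomology.idealPowersDiagram 𝔞) i))

/-- The local cohomology module is the colimit of the `Ext` modules. -/
noncomputable def locCohIsColimit : IsColimit (locCohCocone 𝔞 i X) :=
  isColimitOfPreserves _ (colimit.isColimit _)

/-- The maps from the `Ext` modules to the local cohomology module. -/
noncomputable def locCohι (n : ℕ) :
    extObj i (quotPow 𝔞 n) X →ₗ[R] (localCohomology 𝔞 i).obj X :=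
  ((locCohCocone 𝔞 i X).ι.app (.op (.op n))).hom

/-- The transition maps in the diagram computing local cohomology. -/
noncomputable def locCohMap {n m : ℕ} (h : n ≤ m) :
    extObj i (quotPow 𝔞 n) X →ₗ[R] extObj i (quotPow 𝔞 m) X :=
  (((Ext R (ModuleCat.{u} R) i).map (quotPowMap 𝔞 h).op).app X).hom

lemma locCohι_map {n m : ℕ} (h : n ≤ m) (x : extObj i (quotPow 𝔞 n) X) :
    locCohι 𝔞 i X m (locCohMap 𝔞 i X h x) = locCohι 𝔞 i X n x :=
  congrArg (fun f => f.hom x) ((locCohCocone 𝔞 i X).w (homOfLE h).op.op)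

instance : PreservesColimitsOfShape (ℕᵒᵖ)ᵒᵖ (forget (ModuleCat.{u} R)) :=
  have : PreservesFilteredColimitsOfSize.{0, 0} (forget (ModuleCat.{u} R)) :=
    preservesFilteredColimitsOfSize_shrink.{0, u, 0, u} _
  PreservesFilteredColimitsOfSize.preserves_filtered_colimits _

lemma exists_locCohι_eq (y : (localCohomology 𝔞 i).obj X) : ∃ n x, locCohι 𝔞 i X n x = y := by
  obtain ⟨n, x, hx⟩ := Concrete.isColimit_exists_rep _ (locCohIsColimit 𝔞 i X) y
  exact ⟨n.unop.unop, x, hx⟩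

lemma exists_map_eq_zero {F : (ℕᵒᵖ)ᵒᵖ ⥤ ModuleCat.{u} R} {c : Cocone F} (hc : IsColimit c)
    {j : (ℕᵒᵖ)ᵒᵖ} (x : F.obj j) (hx : (c.ι.app j).hom x = 0) :
    ∃ k, ∃ f : j ⟶ k, (F.map f).hom x = 0 := by
  obtain ⟨k, f, g, hfg⟩ := Concrete.isColimit_exists_of_rep_eq _ hc x (0 : F.obj j)
    (hx.trans (map_zero (c.ι.app j).hom).symm)
  exact ⟨k, f, hfg.trans (map_zero (F.map g).hom)⟩

lemma exists_locCohMap_eq_zero {n : ℕ} (x : extObj i (quotPow 𝔞 n) X)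
    (hx : locCohι 𝔞 i X n x = 0) : ∃ m, ∃ h : n ≤ m, locCohMap 𝔞 i X h x = 0 := by
  obtain ⟨k, f, hf⟩ := exists_map_eq_zero (locCohIsColimit 𝔞 i X) (j := .op (.op n)) x hx
  exact ⟨k.unop.unop, leOfHom f.unop.unop, hf⟩

lemma extRes_extEquiv {n m : ℕ} (h : n ≤ m) (x : extObj i (quotPow 𝔞 n) X) :
    extRes 𝔞 X i h (extEquiv i (quotPow 𝔞 n) X x) =
      extEquiv i (quotPow 𝔞 m) X (locCohMap 𝔞 i X h x) :=
  (extEquiv_naturality _ _ _ _).symm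

/-- The local cohomology module as the colimit of the `Ext` modules in the derived category. -/
noncomputable def locCoh : LocCoh 𝔞 X i ((localCohomology 𝔞 i).obj X) where
  ι n := locCohι 𝔞 i X n ∘ₗ (extEquiv i (quotPow 𝔞 n) X).symm.toLinearMap
  ι_res {n m} h x := by
    obtain ⟨x, rfl⟩ := (extEquiv i (quotPow 𝔞 n) X).surjective x
    rw [extRes_extEquiv]
    simp [locCohι_map]
  exists_rep y := by
    obtain ⟨n, x, hx⟩ := exists_locCohι_eq 𝔞 i X y
    exact ⟨n, extEquiv i _ X x, by simpa using hx⟩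
  exists_res_eq_zero {n} x hx := by
    obtain ⟨x, rfl⟩ := (extEquiv i (quotPow 𝔞 n) X).surjective x
    obtain ⟨m, h, hm⟩ := exists_locCohMap_eq_zero 𝔞 i X x (by simpa using hx)
    exact ⟨m, h, by rw [extRes_extEquiv, hm, map_zero]⟩

end LocalCohomology

section Torsion
variable {R : Type u} [CommRing R] (𝔞 : Ideal R) (X : Type u) [AddCommGroup X] [Module R X]

/-- The `𝔞`-torsion submodule. -/
def tors : Submodule R X where
  carrier := {x | ∃ n : ℕ, ∀ r ∈ 𝔞 ^ n, r • x = 0}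
  zero_mem' := ⟨0, fun r _ => smul_zero r⟩
  add_mem' := by
    rintro x y ⟨n, hn⟩ ⟨m, hm⟩
    refine ⟨n + m, fun r hr => ?_⟩
    rw [smul_add, hn r (Ideal.pow_le_pow_right (Nat.le_add_right n m) hr),
      hm r (Ideal.pow_le_pow_right (Nat.le_add_left m n) hr), add_zero]
  smul_mem' := by
    rintro s x ⟨n, hn⟩
    exact ⟨n, fun r hr => by rw [smul_comm, hn r hr, smul_zero]⟩

variable {𝔞 X}

lemma isTors_tors : IsTors 𝔞 (tors 𝔞 X) := fun x => by
  obtain ⟨n, hn⟩ := x.2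
  exact ⟨n, fun r hr => Subtype.ext (hn r hr)⟩

lemma exists_pow_smul_eq_zero {N : Submodule R X} (hN : N.FG) (h : N ≤ tors 𝔞 X) :
    ∃ n : ℕ, ∀ r ∈ 𝔞 ^ n, ∀ x ∈ N, r • x = 0 := by
  induction N, hN using Submodule.fg_induction with
  | singleton x =>
    obtain ⟨n, hn⟩ := h (Submodule.mem_span_singleton_self x)
    refine ⟨n, fun r hr y hy => ?_⟩
    obtain ⟨s, rfl⟩ := Submodule.mem_span_singleton.1 hy
    rw [smul_comm, hn r hr, smul_zero]
  | sup N₁ N₂ _ _ h₁ h₂ =>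
    obtain ⟨n, hn⟩ := h₁ (le_sup_left.trans h)
    obtain ⟨m, hm⟩ := h₂ (le_sup_right.trans h)
    refine ⟨n + m, fun r hr y hy => ?_⟩
    obtain ⟨y₁, hy₁, y₂, hy₂, rfl⟩ := Submodule.mem_sup.1 hy
    rw [smul_add, hn r (Ideal.pow_le_pow_right (Nat.le_add_right n m) hr) _ hy₁,
      hm r (Ideal.pow_le_pow_right (Nat.le_add_left m n) hr) _ hy₂, add_zero]

lemma tors_quotient_tors [IsNoetherianRing R] : tors 𝔞 (X ⧸ tors 𝔞 X) = ⊥ := by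
  rw [eq_bot_iff]
  intro y hy
  obtain ⟨x, rfl⟩ := Submodule.Quotient.mk_surjective _ y
  obtain ⟨n, hn⟩ := hy
  have h1 : (Submodule.map (LinearMap.toSpanSingleton R X x) (𝔞 ^ n)).FG :=
    (IsNoetherian.noetherian (𝔞 ^ n)).map _
  have h2 : Submodule.map (LinearMap.toSpanSingleton R X x) (𝔞 ^ n) ≤ tors 𝔞 X := by
    rintro _ ⟨r, hr, rfl⟩
    rw [LinearMap.toSpanSingleton_apply, ← Submodule.Quotient.mk_eq_zero]
    exact hn r hr
  obtain ⟨m, hm⟩ := exists_pow_smul_eq_zero h1 h2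
  rw [Submodule.mem_bot, Submodule.Quotient.mk_eq_zero]
  refine ⟨m + n, fun r hr => ?_⟩
  rw [pow_add] at hr
  induction hr using Submodule.mul_induction_on' with
  | mem_mul_mem a ha b hb =>
    rw [mul_smul]
    exact hm a ha _ ⟨b, hb, rfl⟩
  | add a _ b _ h h' => rw [add_smul, h, h', add_zero]

lemma injective_tors [IsNoetherianRing R] [hX : Module.Injective R X] :
    Module.Injective R (tors 𝔞 X) := by
  refine Module.Baer.injective fun I g => ?_
  obtain ⟨n, hn⟩ := exists_pow_smul_eq_zero (𝔞 := 𝔞)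
    (N := LinearMap.range ((tors 𝔞 X).subtype ∘ₗ g))
    (by rw [LinearMap.range_eq_map]; exact (IsNoetherian.noetherian (⊤ : Submodule R I)).map _)
    (by rintro _ ⟨x, rfl⟩; exact (g x).2)
  obtain ⟨k, hk⟩ := Ideal.exists_pow_inf_eq_pow_smul 𝔞 I
  have hker : Submodule.comap I.subtype (𝔞 ^ (n + k)) ≤
      LinearMap.ker ((tors 𝔞 X).subtype ∘ₗ g) := by
    have h1 : 𝔞 ^ n • (⊤ : Submodule R I) ≤ LinearMap.ker ((tors 𝔞 X).subtype ∘ₗ g) := by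
      rw [Submodule.smul_le]
      intro r hr x _
      rw [LinearMap.mem_ker, map_smul]
      exact hn r hr _ ⟨x, rfl⟩
    intro x hx
    have h2 : (x : R) ∈ 𝔞 ^ n • I := by
      have h3 : (x : R) ∈ 𝔞 ^ (n + k) • (⊤ : Submodule R R) ⊓ I :=
        ⟨by simpa using hx, x.2⟩
      rw [hk _ (Nat.le_add_left k n), Nat.add_sub_cancel] at h3
      exact Submodule.smul_mono le_rfl inf_le_right h3
    have h3 : 𝔞 ^ n • I = Submodule.map I.subtype (𝔞 ^ n • (⊤ : Submodule R I)) := by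
      rw [Submodule.map_smul'', Submodule.map_top, Submodule.range_subtype]
    rw [h3] at h2
    obtain ⟨y, hy, hyx⟩ := h2
    rw [← Subtype.ext hyx]
    exact h1 hy
  obtain ⟨f, hf⟩ := hX.out
    (Submodule.mapQ (Submodule.comap I.subtype (𝔞 ^ (n + k))) (𝔞 ^ (n + k)) I.subtype le_rfl)
    (by
      rw [injective_iff_map_eq_zero]
      intro y hy
      obtain ⟨x, rfl⟩ := Submodule.Quotient.mk_surjective _ y
      exact (Submodule.Quotient.mk_eq_zero _).2
        ((Submodule.Quotient.mk_eq_zero (𝔞 ^ (n + k))).1 hy))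
    (Submodule.liftQ _ ((tors 𝔞 X).subtype ∘ₗ g) hker)
  refine ⟨(f ∘ₗ Submodule.mkQ _).codRestrict (tors 𝔞 X) fun r => ⟨n + k, fun s hs => ?_⟩,
    fun x hx => Subtype.ext (hf (Submodule.Quotient.mk ⟨x, hx⟩))⟩
  rw [← map_smul]
  have : (𝔞 ^ (n + k)).mkQ (s • r) = 0 := by
    rw [Submodule.mkQ_apply, Submodule.Quotient.mk_eq_zero]
    exact Ideal.mul_mem_right _ _ hs
  rw [LinearMap.comp_apply, this, map_zero]

lemma injective_quotient_tors [IsNoetherianRing R] [hX : Module.Injective R X] :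
    Module.Injective R (X ⧸ tors 𝔞 X) := by
  obtain ⟨r, hr⟩ := (injective_tors (𝔞 := 𝔞) (X := X)).out (tors 𝔞 X).subtype
    (Submodule.injective_subtype _) LinearMap.id
  let s : (X ⧸ tors 𝔞 X) →ₗ[R] X :=
    (tors 𝔞 X).liftQ (LinearMap.id - (tors 𝔞 X).subtype ∘ₗ r) fun x hx => by
      have : r x = ⟨x, hx⟩ := hr ⟨x, hx⟩
      simp [this]
  have hs : ∀ y, (tors 𝔞 X).mkQ (s y) = y := fun y => by
    obtain ⟨x, rfl⟩ := Submodule.Quotient.mk_surjective _ y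
    simp [s]
  refine ⟨fun A B _ _ _ _ f hf g => ?_⟩
  obtain ⟨h, hh⟩ := hX.out f hf (s ∘ₗ g)
  exact ⟨(tors 𝔞 X).mkQ ∘ₗ h, fun x => by
    rw [LinearMap.comp_apply, hh, LinearMap.comp_apply, hs]⟩

variable (R X) in
lemma exists_embedding_injective : ∃ (E : Type u) (_ : AddCommGroup E) (_ : Module R E)
    (f : X →ₗ[R] E), Function.Injective f ∧ Module.Injective R E :=
  ⟨(Injective.under (ModuleCat.of R X) : ModuleCat.{u} R), inferInstance, inferInstance,
    (Injective.ι (ModuleCat.of R X)).hom, (ModuleCat.mono_iff_injective _).1 inferInstance,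
    Module.injective_module_of_injective_object (inj := Injective.injective_under _)⟩

/-- A torsion-free module embeds in a torsion-free injective module. -/
lemma exists_embedding_of_tors_eq_bot [IsNoetherianRing R] (hX : tors 𝔞 X = ⊥) :
    ∃ (E : Type u) (_ : AddCommGroup E) (_ : Module R E)
    (f : X →ₗ[R] E), Function.Injective f ∧ Module.Injective R E ∧ tors 𝔞 E = ⊥ := by
  obtain ⟨E, _, _, f, hf, hE⟩ := exists_embedding_injective R X
  refine ⟨E ⧸ tors 𝔞 E, inferInstance, inferInstance, (tors 𝔞 E).mkQ ∘ₗ f, ?_,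
    injective_quotient_tors, tors_quotient_tors⟩
  rw [injective_iff_map_eq_zero]
  intro x hx
  rw [LinearMap.comp_apply, Submodule.mkQ_apply, Submodule.Quotient.mk_eq_zero] at hx
  obtain ⟨n, hn⟩ := hx
  have : x ∈ tors 𝔞 X := ⟨n, fun r hr => hf (by rw [map_smul, hn r hr, map_zero])⟩
  simpa [hX] using this

/-- A torsion module embeds in a torsion injective module. -/
lemma IsTors.exists_embedding [IsNoetherianRing R] (hX : IsTors 𝔞 X) :
    ∃ (E : Type u) (_ : AddCommGroup E) (_ : Module R E)
    (f : X →ₗ[R] E), Function.Injective f ∧ Module.Injective R E ∧ IsTors 𝔞 E := by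
  obtain ⟨E, _, _, f, hf, hE⟩ := exists_embedding_injective R X
  refine ⟨tors 𝔞 E, inferInstance, inferInstance, f.codRestrict _ fun x => ?_, ?_,
    injective_tors, isTors_tors⟩
  · obtain ⟨n, hn⟩ := hX x
    exact ⟨n, fun r hr => by rw [← map_smul, hn r hr, map_zero]⟩
  · intro x y h
    exact hf (congrArg Subtype.val h)

end Torsion

section Shift
variable {R : Type u} [CommRing R] {𝔞 : Ideal R}

lemma extRes_comp_eq_zero {X Y : ModuleCat.{u} R} {i j k : ℕ} {n m : ℕ} (h : n ≤ m)
    {x : Abelian.Ext (quotPow 𝔞 n) X i} (hx : extRes 𝔞 X i h x = 0) (y : Abelian.Ext X Y j)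
    (hk : i + j = k) : extRes 𝔞 Y k h (x.comp y hk) = 0 := by
  rw [extRes_comp, hx, Abelian.Ext.zero_comp]

/-- The `0`-th local cohomology is the torsion submodule. -/
noncomputable def locCohZero (𝔞 : Ideal R) (M : Type u) [AddCommGroup M] [Module R M] :
    LocCoh 𝔞 (ModuleCat.of R M) 0 (tors 𝔞 M) where
  ι n := Submodule.inclusion (fun x hx => ⟨n, (mem_ann (𝔞 ^ n)).1 hx⟩) ∘ₗ
    (Abelian.Ext.linearEquiv₀.trans (homEquivAnn (𝔞 ^ n) M)).toLinearMap
  ι_res {n m} h x := by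
    obtain ⟨f, rfl⟩ := Abelian.Ext.linearEquiv₀ (R := R).symm.surjective x
    have : extRes 𝔞 (ModuleCat.of R M) 0 h (Abelian.Ext.linearEquiv₀ (R := R).symm f) =
        Abelian.Ext.linearEquiv₀ (R := R).symm (quotPowMap 𝔞 h ≫ f) :=
      Abelian.Ext.mk₀_comp_mk₀ _ _
    rw [this]
    simp only [LinearMap.comp_apply, LinearEquiv.coe_coe, LinearEquiv.trans_apply,
      LinearEquiv.apply_symm_apply]
    rfl
  exists_rep y := by
    obtain ⟨n, hn⟩ := y.2
    refine ⟨n, (Abelian.Ext.linearEquiv₀.trans (homEquivAnn (𝔞 ^ n) M)).symm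
      ⟨y, (mem_ann _).2 hn⟩, ?_⟩
    rw [LinearMap.comp_apply, LinearEquiv.coe_coe, LinearEquiv.apply_symm_apply]
    rfl
  exists_res_eq_zero {n} x hx := by
    refine ⟨n, le_rfl, ?_⟩
    rw [extRes_self]
    refine (Abelian.Ext.linearEquiv₀.trans (homEquivAnn (𝔞 ^ n) M)).injective ?_
    rw [map_zero]
    exact Submodule.inclusion_injective _ (by simpa using hx)

/-- Transport of a colimit presentation along natural maps which are surjective and injective
up to passing further in the directed system. -/
noncomputable def LocCoh.precomp {X Y : ModuleCat.{u} R} {i j : ℕ} {H : Type u} [AddCommGroup H]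
    [Module R H] (D : LocCoh 𝔞 Y j H)
    (α : ∀ n, Abelian.Ext (quotPow 𝔞 n) X i →ₗ[R] Abelian.Ext (quotPow 𝔞 n) Y j)
    (hα : ∀ {n m : ℕ} (h : n ≤ m) (x : Abelian.Ext (quotPow 𝔞 n) X i),
      α m (extRes 𝔞 X i h x) = extRes 𝔞 Y j h (α n x))
    (hs : ∀ n (y : Abelian.Ext (quotPow 𝔞 n) Y j), ∃ m, ∃ h : n ≤ m, ∃ x,
      α m x = extRes 𝔞 Y j h y)
    (hi : ∀ n (x : Abelian.Ext (quotPow 𝔞 n) X i), α n x = 0 →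
      ∃ m, ∃ h : n ≤ m, extRes 𝔞 X i h x = 0) : LocCoh 𝔞 X i H where
  ι n := D.ι n ∘ₗ α n
  ι_res h x := by simp [hα, D.ι_res]
  exists_rep y := by
    obtain ⟨n, z, rfl⟩ := D.exists_rep y
    obtain ⟨m, h, x, hx⟩ := hs n z
    exact ⟨m, x, by rw [LinearMap.comp_apply, hx, D.ι_res]⟩
  exists_res_eq_zero {n} x hx := by
    obtain ⟨m, h, hm⟩ := D.exists_res_eq_zero _ hx
    rw [← hα] at hm
    obtain ⟨k, h', hk⟩ := hi _ _ hm
    exact ⟨k, h.trans h', by rw [← extRes_extRes 𝔞 X i h h', hk]⟩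

lemma ext_eq_zero_of_tors_eq_bot {E : Type u} [AddCommGroup E] [Module R E]
    [Module.Injective R E] (hE : tors 𝔞 E = ⊥) (n j : ℕ)
    (x : Abelian.Ext (quotPow 𝔞 n) (ModuleCat.of R E) j) : x = 0 := by
  have := Module.injective_object_of_injective_module R E
  cases j with
  | zero =>
    refine (Abelian.Ext.linearEquiv₀.trans (homEquivAnn (𝔞 ^ n) E)).injective ?_
    rw [map_zero]
    generalize (Abelian.Ext.linearEquiv₀.trans (homEquivAnn (𝔞 ^ n) E)) x = y
    have h : (y : E) ∈ tors 𝔞 E := ⟨n, (mem_ann (𝔞 ^ n)).1 y.2⟩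
    rw [hE] at h
    exact Subtype.ext h
  | succ j => exact Abelian.Ext.eq_zero_of_injective x

variable {X Y Z : Type u} [AddCommGroup X] [Module R X] [AddCommGroup Y] [Module R Y]
  [AddCommGroup Z] [Module R Z] {f : X →ₗ[R] Y} {g : Y →ₗ[R] Z}

/-- Dimension shifting for local cohomology. -/
noncomputable def LocCoh.shift (hf : Function.Injective f) (hg : Function.Surjective g)
    (hfg : Function.Exact f g) [Module.Injective R Y] (hY : tors 𝔞 Y = ⊥) {i : ℕ} {H : Type u}
    [AddCommGroup H] [Module R H] (D : LocCoh 𝔞 (ModuleCat.of R X) (i + 1) H) :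
    LocCoh 𝔞 (ModuleCat.of R Z) i H :=
  D.precomp
    (fun n => (shortExact_of hf hg hfg).extClass.postcompOfLinear R (quotPow 𝔞 n) rfl)
    (fun h x => (extRes_comp 𝔞 h x _ rfl).symm)
    (fun n y => by
      obtain ⟨x, hx⟩ := Abelian.Ext.covariant_sequence_exact₁ _ (shortExact_of hf hg hfg) y
        (ext_eq_zero_of_tors_eq_bot hY n _ _) rfl
      exact ⟨n, le_rfl, x, by rw [extRes_self]; exact hx⟩)
    (fun n x hx => by
      obtain ⟨z, rfl⟩ := Abelian.Ext.covariant_sequence_exact₃ _ (shortExact_of hf hg hfg) x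
        rfl hx
      exact ⟨n, le_rfl, by
        rw [extRes_self, ext_eq_zero_of_tors_eq_bot hY n _ z, Abelian.Ext.zero_comp]⟩)

lemma IsTors.exists_extRes_eq_zero [IsNoetherianRing R] (hX : IsTors 𝔞 X) (i : ℕ) {n : ℕ}
    (x : Abelian.Ext (quotPow 𝔞 n) (ModuleCat.of R X) (i + 1)) :
    ∃ m, ∃ h : n ≤ m, extRes 𝔞 (ModuleCat.of R X) (i + 1) h x = 0 := by
  induction i generalizing X n with
  | zero =>
    obtain ⟨E, _, _, f, hf, hE, hET⟩ := hX.exists_embedding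
    have := Module.injective_object_of_injective_module R E
    have hS := shortExact_of hf (Submodule.mkQ_surjective _)
      ((LinearMap.exact_map_mkQ_range f))
    obtain ⟨y, rfl⟩ := Abelian.Ext.covariant_sequence_exact₁ _ hS x
      (Abelian.Ext.eq_zero_of_injective _) (n₀ := 0) rfl
    obtain ⟨φ, rfl⟩ := Abelian.Ext.linearEquiv₀ (R := R).symm.surjective y
    obtain ⟨e, he⟩ := Submodule.mkQ_surjective (LinearMap.range f)
      (φ.hom (Ideal.Quotient.mk (𝔞 ^ n) 1))
    obtain ⟨k, hk⟩ := hET e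
    have h1 : ∀ r ∈ 𝔞 ^ (n + k), r • e = 0 :=
      fun r hr => hk r (Ideal.pow_le_pow_right (Nat.le_add_left k n) hr)
    let ψ : quotPow 𝔞 (n + k) ⟶ ModuleCat.of R E :=
      (homEquivAnn (𝔞 ^ (n + k)) E).symm ⟨e, (mem_ann _).2 h1⟩
    refine ⟨n + k, Nat.le_add_right n k, ?_⟩
    rw [extRes_comp]
    have h2 : extRes 𝔞 _ 0 (Nat.le_add_right n k) (Abelian.Ext.linearEquiv₀ (R := R).symm φ) =
        (Abelian.Ext.mk₀ ψ).comp (Abelian.Ext.mk₀ (ModuleCat.ofHom (LinearMap.range f).mkQ))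
          (add_zero 0) := by
      rw [Abelian.Ext.mk₀_comp_mk₀]
      refine (Abelian.Ext.mk₀_comp_mk₀ _ _).trans (congrArg _ ?_)
      refine ModuleCat.hom_ext (LinearMap.ext fun z => ?_)
      obtain ⟨r, rfl⟩ := Submodule.Quotient.mk_surjective _ z
      change φ.hom (Submodule.Quotient.mk r) = (LinearMap.range f).mkQ (r • e)
      rw [map_smul, he, ← map_smul]
      congr 1
      change _ = r • (Submodule.Quotient.mk 1 : R ⧸ 𝔞 ^ n)
      rw [← Submodule.Quotient.mk_smul, smul_eq_mul, mul_one]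
    rw [h2]
    exact (Abelian.Ext.comp_assoc_of_second_deg_zero _ _ _ _).trans
      (by rw [hS.comp_extClass, Abelian.Ext.comp_zero])
  | succ i ih =>
    obtain ⟨E, _, _, f, hf, hE, hET⟩ := hX.exists_embedding
    have := Module.injective_object_of_injective_module R E
    have hS := shortExact_of hf (Submodule.mkQ_surjective _)
      ((LinearMap.exact_map_mkQ_range f))
    obtain ⟨y, rfl⟩ := Abelian.Ext.covariant_sequence_exact₁ _ hS x
      (Abelian.Ext.eq_zero_of_injective _) (n₀ := i + 1) rfl
    obtain ⟨m, h, hm⟩ := ih (hET.of_surjective _ (Submodule.mkQ_surjective (LinearMap.range f))) y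
    exact ⟨m, h, extRes_comp_eq_zero h hm _ rfl⟩

/-- Positive local cohomology does not change when a torsion submodule is factored out. -/
noncomputable def LocCoh.ofQuotient [IsNoetherianRing R] (hf : Function.Injective f)
    (hg : Function.Surjective g) (hfg : Function.Exact f g) (hX : IsTors 𝔞 X) {i : ℕ} {H : Type u}
    [AddCommGroup H] [Module R H] (D : LocCoh 𝔞 (ModuleCat.of R Z) (i + 1) H) :
    LocCoh 𝔞 (ModuleCat.of R Y) (i + 1) H :=
  D.precomp
    (fun n => (Abelian.Ext.mk₀ (ModuleCat.ofHom g)).postcompOfLinear R (quotPow 𝔞 n) (add_zero _))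
    (fun h x => (extRes_comp 𝔞 h x _ (add_zero _)).symm)
    (fun n y => by
      obtain ⟨m, h, hm⟩ := hX.exists_extRes_eq_zero (i + 1)
        (y.comp (shortExact_of hf hg hfg).extClass rfl)
      rw [extRes_comp] at hm
      obtain ⟨x, hx⟩ := Abelian.Ext.covariant_sequence_exact₃ _ (shortExact_of hf hg hfg) _ rfl hm
      exact ⟨m, h, x, hx⟩)
    (fun n x hx => by
      obtain ⟨z, rfl⟩ := Abelian.Ext.covariant_sequence_exact₂ _ (shortExact_of hf hg hfg) x hx
      obtain ⟨m, h, hm⟩ := hX.exists_extRes_eq_zero i z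
      exact ⟨m, h, extRes_comp_eq_zero h hm _ (add_zero _)⟩)

end Shift

section Main
variable {R : Type u} [CommRing R] {𝔞 : Ideal R}

lemma isFDLT_of_linearEquiv {n : ℕ} {X Y : Type u} [AddCommGroup X] [Module R X]
    [AddCommGroup Y] [Module R Y] (e : X ≃ₗ[R] Y) (h : IsFDLT R n X) : IsFDLT R n Y := by
  obtain ⟨N, hN, hd⟩ := h
  refine ⟨N.map e.toLinearMap, hN.map _, ?_⟩
  rwa [← (Submodule.Quotient.equiv N (N.map e.toLinearMap) e rfl).support_eq]

lemma IsTors.support_subset {X : Type u} [AddCommGroup X] [Module R X] (h : IsTors 𝔞 X) :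
    Module.support R X ⊆ PrimeSpectrum.zeroLocus (𝔞 : Set R) := by
  intro p hp
  obtain ⟨x, hx⟩ := Module.mem_support_iff'.1 hp
  obtain ⟨n, hn⟩ := h x
  rw [PrimeSpectrum.mem_zeroLocus]
  intro r hr
  by_contra hrp
  exact hx (r ^ n) (fun h' => hrp (p.2.mem_of_pow_mem n h')) (hn _ (Ideal.pow_mem_pow hr n))

lemma extFinite_iff_extModule (X : Type u) [AddCommGroup X] [Module R X] (i : ℕ) :
    ExtFinite 𝔞 X i ↔ Module.Finite R (extModule R (R ⧸ 𝔞) X i) :=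
  (Module.Finite.equiv_iff (extEquiv i (ModuleCat.of R (R ⧸ 𝔞)) (ModuleCat.of R X))).symm

lemma ann_eq_bot_of_tors_eq_bot {X : Type u} [AddCommGroup X] [Module R X]
    (h : tors 𝔞 X = ⊥) : ann 𝔞 X = ⊥ := by
  rw [eq_bot_iff, ← h]
  exact fun x hx => ⟨1, fun r hr => (mem_ann 𝔞).1 hx r (by simpa using hr)⟩

lemma extFinite_zero_of_tors_eq_bot {X : Type u} [AddCommGroup X] [Module R X]
    (h : tors 𝔞 X = ⊥) : ExtFinite 𝔞 X 0 := by
  rw [extFinite_zero_iff, ann_eq_bot_of_tors_eq_bot h]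
  infer_instance

lemma extFinite_of_injective_of_tors_eq_bot {E : Type u} [AddCommGroup E] [Module R E]
    [Module.Injective R E] (h : tors 𝔞 E = ⊥) (j : ℕ) : ExtFinite 𝔞 E j := by
  cases j with
  | zero => exact extFinite_zero_of_tors_eq_bot h
  | succ j =>
    have := Module.injective_object_of_injective_module R E
    have : Subsingleton (Abelian.Ext (ModuleCat.of R (R ⧸ 𝔞)) (ModuleCat.of R E) (j + 1)) :=
      subsingleton_of_forall_eq 0 Abelian.Ext.eq_zero_of_injective
    exact Module.Finite.of_finite

/-- The torsion submodule inherits finiteness of `Ext` from the module. -/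
lemma extFinite_tors [IsNoetherianRing R] {M : Type u} [AddCommGroup M] [Module R M]
    (hM : ∀ j, ExtFinite 𝔞 M j) (hT : IsFDLT R 2 (tors 𝔞 M)) (j : ℕ) :
    ExtFinite 𝔞 (tors 𝔞 M) j :=
  isTors_tors.extFinite_of_isFDLT hT
    (ExtFinite.zero_of_injective 𝔞 (Submodule.subtype_injective _) (hM 0))
    (ExtFinite.left 𝔞 (Submodule.subtype_injective _) (Submodule.mkQ_surjective _)
      (LinearMap.exact_subtype_mkQ _) (extFinite_zero_of_tors_eq_bot tors_quotient_tors) (hM 1)) j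

theorem extFinite_localCohomologyModule [IsNoetherianRing R] (i : ℕ) :
    ∀ (M : Type u) [AddCommGroup M] [Module R M] (_ : ∀ j, ExtFinite 𝔞 M j)
      (_ : ∀ j, IsFDLT R 2 (localCohomologyModule R 𝔞 M j)) (j : ℕ),
      ExtFinite 𝔞 (localCohomologyModule R 𝔞 M i) j := by
  induction i with
  | zero =>
    intro M _ _ hM hH j
    let e : tors 𝔞 M ≃ₗ[R] localCohomologyModule R 𝔞 M 0 :=
      (locCohZero 𝔞 M).equiv (locCoh 𝔞 0 (ModuleCat.of R M))
    exact (extFinite_tors hM (isFDLT_of_linearEquiv e.symm (hH 0)) j).of_linearEquiv 𝔞 e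
  | succ i ih =>
    intro M _ _ hM hH j
    let e : tors 𝔞 M ≃ₗ[R] localCohomologyModule R 𝔞 M 0 :=
      (locCohZero 𝔞 M).equiv (locCoh 𝔞 0 (ModuleCat.of R M))
    have hT := extFinite_tors hM (isFDLT_of_linearEquiv e.symm (hH 0))
    have hQ (j : ℕ) : ExtFinite 𝔞 (M ⧸ tors 𝔞 M) j :=
      ExtFinite.right 𝔞 (Submodule.subtype_injective _) (Submodule.mkQ_surjective _)
        (LinearMap.exact_subtype_mkQ _) (hM j) (hT (j + 1))
    obtain ⟨E, _, _, f, hf, hE, hE0⟩ :=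
      exists_embedding_of_tors_eq_bot (tors_quotient_tors (𝔞 := 𝔞) (X := M))
    have hL (j : ℕ) : ExtFinite 𝔞 (E ⧸ LinearMap.range f) j :=
      ExtFinite.right 𝔞 hf (Submodule.mkQ_surjective _) (LinearMap.exact_map_mkQ_range f)
        (extFinite_of_injective_of_tors_eq_bot hE0 j) (hQ (j + 1))
    have shift (k : ℕ) : Nonempty (localCohomologyModule R 𝔞 M (k + 1) ≃ₗ[R]
        localCohomologyModule R 𝔞 (E ⧸ LinearMap.range f) k) := by
      let D := LocCoh.shift hf (Submodule.mkQ_surjective _) (LinearMap.exact_map_mkQ_range f) hE0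
        (locCoh 𝔞 (k + 1) (ModuleCat.of R (M ⧸ tors 𝔞 M)))
      let D' := LocCoh.ofQuotient (Submodule.subtype_injective _) (Submodule.mkQ_surjective _)
        (LinearMap.exact_subtype_mkQ _) isTors_tors
        (locCoh 𝔞 (k + 1) (ModuleCat.of R (M ⧸ tors 𝔞 M)))
      exact ⟨((locCoh 𝔞 (k + 1) (ModuleCat.of R M)).equiv D').trans
        (D.equiv (locCoh 𝔞 k (ModuleCat.of R (E ⧸ LinearMap.range f))))⟩
    refine (ih _ hL (fun k => ?_) j).of_linearEquiv 𝔞 (shift i).some.symm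
    exact isFDLT_of_linearEquiv (shift k).some (hH (k + 1))

end Main

end CofiniteModule

/-- Corollary 3.2: if `Ext^i_R(R/𝔞, M)` is finite for all `i` and `H^i_𝔞(M)` is `FD_{<2}`
for all `i`, then `H^i_𝔞(M)` is `𝔞`-cofinite for all `i`. -/
theorem localCohomology_isCofinite_of_isFDLT_two_of_ext_finite
    (R : Type u) [CommRing R] [IsNoetherianRing R] (𝔞 : Ideal R)
    (M : Type u) [AddCommGroup M] [Module R M]
    (hext : ∀ i : ℕ, Module.Finite R (extModule R (R ⧸ 𝔞) M i))
    (hfd : ∀ i : ℕ, IsFDLT R 2 (localCohomologyModule R 𝔞 M i)) :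
    ∀ i : ℕ, IsCofinite R 𝔞 (localCohomologyModule R 𝔞 M i) := by
  open CofiniteModule in
  exact fun i => ⟨(locCoh 𝔞 i (ModuleCat.of R M)).isTors.support_subset, fun j =>
    (extFinite_iff_extModule _ j).1 (extFinite_localCohomologyModule i M
      (fun k => (extFinite_iff_extModule M k).2 (hext k)) hfd j)⟩
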